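/- arXiv:2105.12418 — 6 statements merged into one kernel-verified Lean document; each statement's English description precedes it below -/
import Mathlib

section
/- Let s_{11}, s_{12}, s_{13}, s_{21}, s_{22}, s_{31}, s_{32} be complex numbers with Re(s_{12}) ≥ 1, Re(s_{31}) ≥ 1 and Re(s_{11}), Re(s_{13}), Re(s_{21}), Re(s_{22}), Re(s_{32}) > 1. For the partition (3,2,2) with filling rows (s_{11},s_{12},s_{13}), (s_{21},s_{22}), (s_{31},s_{32}), let F(s) denote the expression det[[ζ⋆(s_{11},s_{12},s_{13}), ζ⋆(s_{21},s_{22},s_{12},s_{13}), ζ⋆(s_{31},s_{32},s_{22},s_{12},s_{13})], [ζ⋆(s_{11}), ζ⋆(s_{21},s_{22}), ζ⋆(s_{31},s_{32},s_{22})], [1, ζ⋆(s_{21}), ζ⋆(s_{31},s_{32})]] + (ζ⋆(s_{21},s_{11},s_{12},s_{13}) − ζ⋆(s_{21},s_{22},s_{12},s_{13}))·ζ⋆(s_{31},s_{32},s_{22}) − (ζ⋆(s_{21},s_{11}) − ζ⋆(s_{21},s_{22}))·ζ⋆(s_{31},s_{32},s_{22},s_{12},s_{13}). Let the symbol Σ_diag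 applied to an expression mean the sum of its four versions obtained by independently either keeping or exchanging the pair (s_{11}, s_{22}) and either keeping or exchanging the pair (s_{21}, s_{32}). Then Σ_diag ζ_{(3,2,2)}(s) = Σ_diag F(s). -/
open scoped BigOperators

/-- The multiple zeta function `ζ(s₁,…,s_r) = Σ_{0<n₁<⋯<n_r} Π nᵢ^{-sᵢ}`
(equal to `1` for the empty tuple). -/
noncomputable def MZV (s : List ℂ) : ℂ :=
  ∑' n : {f : Fin s.length → ℕ+ // StrictMono f},
    ∏ i : Fin s.length, (n.1 i : ℂ) ^ (-(s.get i))

/-- The multiple zeta-star function `ζ⋆(s₁,…,s_r) = Σ_{0<n₁≤⋯≤n_r} Π nᵢ^{-sᵢ}`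
(equal to `1` for the empty tuple). -/
noncomputable def MZSV (s : List ℂ) : ℂ :=
  ∑' n : {f : Fin s.length → ℕ+ // Monotone f},
    ∏ i : Fin s.length, (n.1 i : ℂ) ^ (-(s.get i))

/-- The Schur multiple zeta function of shape `μ` with (0-indexed) filling `s`.
Mathlib's semistandard Young tableaux have entries in `ℕ = {0,1,2,…}`, so the entry is
shifted by `1` to make it range over the positive integers. -/
noncomputable def schurZeta (μ : YoungDiagram) (s : ℕ → ℕ → ℂ) : ℂ :=
  ∑' T : SemistandardYoungTableau μ,
    ∏ c ∈ μ.cells, (((T c.1 c.2 + 1 : ℕ) : ℂ)) ^ (-(s c.1 c.2))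

/-- A filling of a Young diagram given by its list of rows (0 outside). -/
def fillOfRows (rows : List (List ℂ)) : ℕ → ℕ → ℂ := fun i j => (rows.getD i []).getD j 0

/-- The Schur multiple zeta value of shape `(3,2,2)` with rows `(a,b,c)`, `(d,e)`, `(f,g)`. -/
noncomputable def Z322 (a b c d e f g : ℂ) : ℂ :=
  schurZeta (YoungDiagram.ofRowLens [3, 2, 2] (by decide)) (fillOfRows [[a, b, c], [d, e], [f, g]])

/-- The right-hand side expression `F(s)` of the extended Jacobi–Trudi formula for shape
`(3,2,2)` with rows `(a,b,c)`, `(d,e)`, `(f,g)`: a `3×3` determinant of multiple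
zeta-star values plus the error terms. -/
noncomputable def F322 (a b c d e f g : ℂ) : ℂ :=
  Matrix.det !![MZSV [a, b, c], MZSV [d, e, b, c], MZSV [f, g, e, b, c];
                MZSV [a],       MZSV [d, e],       MZSV [f, g, e];
                1,              MZSV [d],          MZSV [f, g]]
  + (MZSV [d, a, b, c] - MZSV [d, e, b, c]) * MZSV [f, g, e]
  - (MZSV [d, a] - MZSV [d, e]) * MZSV [f, g, e, b, c]


theorem summable_pi_fin_prod {k : ℕ} {u : ℕ+ → ℝ} (hu : Summable u) (hu0 : ∀ n, 0 ≤ u n) :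
    Summable fun f : Fin k → ℕ+ => ∏ i, u (f i) := by
  induction k with
  | zero => exact Summable.of_finite
  | succ k ih =>
    rw [← (Fin.consEquiv fun _ : Fin (k + 1) => ℕ+).summable_iff]
    have := hu.mul_of_nonneg ih hu0 fun f => Finset.prod_nonneg fun i _ => hu0 _
    refine this.congr fun x => ?_
    simp [Fin.prod_univ_succ, Fin.consEquiv]

/-- The monomial `∏ nᵢ ^ (-tᵢ)`. -/
noncomputable def dirichletTerm {ι : Type*} [Fintype ι] (t : ι → ℂ) (n : ι → ℕ+) : ℂ :=
  ∏ i, (n i : ℂ) ^ (-(t i))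

open Classical in
/-- The summand of the multiple zeta-star function, extended by `0` to all tuples. -/
noncomputable def starTerm {ι : Type*} [Fintype ι] [Preorder ι] (t : ι → ℂ) (n : ι → ℕ+) : ℂ :=
  if Monotone n then dirichletTerm t n else 0

theorem norm_dirichletTerm {ι : Type*} [Fintype ι] (t : ι → ℂ) (n : ι → ℕ+) :
    ‖dirichletTerm t n‖ = ∏ i, (n i : ℝ) ^ (-(t i).re) := by
  simp only [dirichletTerm, norm_prod]
  refine Finset.prod_congr rfl fun i _ => ?_
  rw [Complex.norm_natCast_cpow_of_pos (n i).pos, Complex.neg_re]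

theorem summable_norm_starTerm {k : ℕ} (t : Fin (k + 1) → ℂ) (h : ∀ i, 1 ≤ (t i).re)
    (hlast : 1 < (t (Fin.last k)).re) : Summable fun n => ‖starTerm t n‖ := by
  obtain ⟨ε, hε, hle⟩ : ∃ ε : ℝ, 0 < ε ∧ 1 + ε + k * ε ≤ (t (Fin.last k)).re := by
    refine ⟨((t (Fin.last k)).re - 1) / (k + 1), div_pos (by linarith) (by positivity), ?_⟩
    field_simp
    linarith
  have hu : Summable fun n : ℕ+ => (n : ℝ) ^ (-(1 + ε)) := by
    have := (Real.summable_nat_rpow (p := -(1 + ε))).2 (by linarith)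
    exact this.comp_injective PNat.coe_injective
  refine (summable_pi_fin_prod (k := k + 1) hu fun n => by positivity).of_nonneg_of_le
    (fun n => norm_nonneg _) fun n => ?_
  unfold starTerm
  split_ifs with hn
  swap
  · simpa using Finset.prod_nonneg fun i _ => by positivity
  have one_le (i) : (1 : ℝ) ≤ n i := Nat.one_le_cast.2 (n i).pos
  have pos (i) : (0 : ℝ) < n i := zero_lt_one.trans_le (one_le i)
  rw [norm_dirichletTerm, Fin.prod_univ_castSucc, Fin.prod_univ_castSucc (n := k)]
  calc _ ≤ (∏ i : Fin k, (n i.castSucc : ℝ) ^ (-(1 + ε)) * (n (Fin.last k) : ℝ) ^ ε) *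
        (n (Fin.last k) : ℝ) ^ (-(t (Fin.last k)).re) := by
        refine mul_le_mul_of_nonneg_right (Finset.prod_le_prod (fun i _ => by positivity) ?_)
          (by positivity)
        intro i _
        have hiN : (n i.castSucc : ℝ) ≤ (n (Fin.last k) : ℝ) := by
          exact_mod_cast hn (Fin.le_last _)
        calc (n i.castSucc : ℝ) ^ (-(t i.castSucc).re) ≤ (n i.castSucc : ℝ) ^ (-(1 + ε) + ε) :=
              Real.rpow_le_rpow_of_exponent_le (one_le _) (by linarith [h i.castSucc])
          _ = (n i.castSucc : ℝ) ^ (-(1 + ε)) * (n i.castSucc : ℝ) ^ ε := Real.rpow_add (pos _) _ _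
          _ ≤ _ := by gcongr
    _ = (∏ i : Fin k, (n i.castSucc : ℝ) ^ (-(1 + ε))) *
        (n (Fin.last k) : ℝ) ^ (k * ε - (t (Fin.last k)).re) := by
        rw [Finset.prod_mul_distrib, Finset.prod_const, Finset.card_univ, Fintype.card_fin,
          mul_assoc, ← Real.rpow_mul_natCast (pos _).le, ← Real.rpow_add (pos _)]
        ring_nf
    _ ≤ _ := by
        refine mul_le_mul_of_nonneg_left ?_ (Finset.prod_nonneg fun i _ => by positivity)
        exact Real.rpow_le_rpow_of_exponent_le (one_le _) (by linarith)

/-- A product of three absolutely convergent sums over tuples as one sum over tuples indexed by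
the disjoint union of the three index sets. -/
theorem hasSum_mul_mul_arrow {ι κ τ σ : Type*} {F : (ι → ℕ+) → ℂ} {G : (κ → ℕ+) → ℂ}
    {H : (τ → ℕ+) → ℂ} (hF : Summable fun n => ‖F n‖) (hG : Summable fun n => ‖G n‖)
    (hH : Summable fun n => ‖H n‖) {p : ι → σ} {q : κ → σ} {r : τ → σ}
    (hb : Function.Bijective (Sum.elim p (Sum.elim q r))) :
    HasSum (fun n : σ → ℕ+ => F (n ∘ p) * (G (n ∘ q) * H (n ∘ r)))
      ((∑' n, F n) * ((∑' n, G n) * ∑' n, H n)) := by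
  have hGH : Summable fun n : (κ → ℕ+) × (τ → ℕ+) => ‖G n.1 * H n.2‖ := hG.mul_norm hH
  have hFGH : Summable fun n : (ι → ℕ+) × (κ → ℕ+) × (τ → ℕ+) => F n.1 * (G n.2.1 * H n.2.2) :=
    summable_mul_of_summable_norm (g := fun n : (κ → ℕ+) × (τ → ℕ+) => G n.1 * H n.2) hF hGH
  have heq : (∑' n, F n) * ((∑' n, G n) * ∑' n, H n) =
      ∑' n : (ι → ℕ+) × (κ → ℕ+) × (τ → ℕ+), F n.1 * (G n.2.1 * H n.2.2) := by
    rw [tsum_mul_tsum_of_summable_norm hG hH]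
    exact tsum_mul_tsum_of_summable_norm
      (g := fun n : (κ → ℕ+) × (τ → ℕ+) => G n.1 * H n.2) hF hGH
  let e : (σ → ℕ+) ≃ (ι → ℕ+) × (κ → ℕ+) × (τ → ℕ+) :=
    (((Equiv.ofBijective _ hb).arrowCongr (Equiv.refl ℕ+)).symm.trans
      (Equiv.sumArrowEquivProdArrow _ _ _)).trans
      ((Equiv.refl _).prodCongr (Equiv.sumArrowEquivProdArrow _ _ _))
  rw [heq]
  exact (Equiv.hasSum_iff (f := fun n : (ι → ℕ+) × (κ → ℕ+) × (τ → ℕ+) =>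
    F n.1 * (G n.2.1 * H n.2.2)) e).2 hFGH.hasSum

open Classical in
theorem MZSV_eq_tsum_starTerm {k : ℕ} (l : List ℂ) (t : Fin k → ℂ) (hl : l = List.ofFn t) :
    MZSV l = ∑' n, starTerm t n := by
  obtain rfl : l.length = k := by simp [hl]
  obtain rfl : t = l.get := by
    apply List.ofFn_injective
    rw [← hl, List.ofFn_get]
  have := tsum_subtype {f : Fin l.length → ℕ+ | Monotone f} (dirichletTerm l.get)
  refine this.trans (tsum_congr fun n => ?_)
  simp [starTerm, Set.indicator_apply]

/-- Labels of the cells of the shape `(3,2,2)`, numbered row by row from left to right. -/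
def cell322 : Fin 7 → ℕ × ℕ := ![(0, 0), (0, 1), (0, 2), (1, 0), (1, 1), (2, 0), (2, 1)]

theorem cell322_injective : Function.Injective cell322 := by decide

theorem cells_322 : (YoungDiagram.ofRowLens [3, 2, 2] (by decide)).cells =
    Finset.univ.map ⟨cell322, cell322_injective⟩ := by
  decide

theorem mem_322 {i j : ℕ} : (i, j) ∈ YoungDiagram.ofRowLens [3, 2, 2] (by decide) ↔
    i = 0 ∧ j < 3 ∨ i = 1 ∧ j < 2 ∨ i = 2 ∧ j < 2 := by
  rw [← YoungDiagram.mem_cells, cells_322]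
  simp [Fin.exists_fin_succ, cell322]
  omega

/-- The row and column conditions on the entries of a tableau of shape `(3,2,2)`. -/
abbrev IsTableau322 (n : Fin 7 → ℕ+) : Prop :=
  (n 0 ≤ n 1 ∧ n 1 ≤ n 2) ∧ n 3 ≤ n 4 ∧ n 5 ≤ n 6 ∧ n 0 < n 3 ∧ n 3 < n 5 ∧ n 1 < n 4 ∧ n 4 < n 6

/-- The entries of a tableau of shape `(3,2,2)`, row by row and shifted to be positive. -/
def entries322 (T : SemistandardYoungTableau (YoungDiagram.ofRowLens [3, 2, 2] (by decide)))
    (k : Fin 7) : ℕ+ :=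
  (T (cell322 k).1 (cell322 k).2).succPNat

theorem entries322_injective : Function.Injective entries322 := by
  intro T T' h
  ext i j
  by_cases hij : (i, j) ∈ YoungDiagram.ofRowLens [3, 2, 2] (by decide)
  · rw [← YoungDiagram.mem_cells, cells_322, Finset.mem_map] at hij
    obtain ⟨k, -, hk⟩ := hij
    have := Nat.succPNat_injective (congrFun h k)
    change cell322 k = (i, j) at hk
    rwa [hk] at this
  · rw [T.zeros hij, T'.zeros hij]

theorem isTableau322_entries322
    (T : SemistandardYoungTableau (YoungDiagram.ofRowLens [3, 2, 2] (by decide))) :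
    IsTableau322 (entries322 T) := by
  have row {i j₁ j₂ : ℕ} (hj : j₁ < j₂) (h : (i, j₂) ∈ _) :
      (T i j₁).succPNat ≤ (T i j₂).succPNat := Nat.succPNat_le_succPNat.2 (T.row_weak hj h)
  have col {i₁ i₂ j : ℕ} (hi : i₁ < i₂) (h : (i₂, j) ∈ _) :
      (T i₁ j).succPNat < (T i₂ j).succPNat := Nat.succPNat_lt_succPNat.2 (T.col_strict hi h)
  refine ⟨⟨row ?_ ?_, row ?_ ?_⟩, row ?_ ?_, row ?_ ?_, col ?_ ?_, col ?_ ?_, col ?_ ?_,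
    col ?_ ?_⟩ <;> simp [cell322, mem_322]

theorem exists_entries322_eq {n : Fin 7 → ℕ+} (hn : IsTableau322 n) : ∃ T, entries322 T = n := by
  let entry : ℕ → ℕ → ℕ := fun i j => match i, j with
    | 0, 0 => (n 0).natPred
    | 0, 1 => (n 1).natPred
    | 0, 2 => (n 2).natPred
    | 1, 0 => (n 3).natPred
    | 1, 1 => (n 4).natPred
    | 2, 0 => (n 5).natPred
    | 2, 1 => (n 6).natPred
    | _, _ => 0
  obtain ⟨⟨h01, h12⟩, h34, h56, h03, h35, h14, h46⟩ := hn
  refine ⟨⟨entry, fun {i j₁ j₂} hj h => ?_, fun {i₁ i₂ j} hi h => ?_, fun {i j} h => ?_⟩, ?_⟩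
  · obtain ⟨rfl, h⟩ | ⟨rfl, h⟩ | ⟨rfl, h⟩ := mem_322.1 h <;> interval_cases j₂ <;>
      interval_cases j₁ <;> simp only [entry, PNat.natPred_le_natPred] <;> order
  · obtain ⟨rfl, h⟩ | ⟨rfl, h⟩ | ⟨rfl, h⟩ := mem_322.1 h <;> interval_cases i₁ <;>
      interval_cases j <;> simp only [entry, PNat.natPred_lt_natPred] <;> order
  · rw [mem_322] at h
    simp only [entry]
    split <;> first | rfl | (exfalso; omega)
  · funext k
    fin_cases k <;> exact PNat.succPNat_natPred _

theorem Z322_eq_tsum (s : Fin 7 → ℂ) :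
    Z322 (s 0) (s 1) (s 2) (s 3) (s 4) (s 5) (s 6) =
      ∑' n : Fin 7 → ℕ+, if IsTableau322 n then dirichletTerm s n else 0 := by
  rw [← entries322_injective.tsum_eq]
  · refine tsum_congr fun T => ?_
    rw [if_pos (isTableau322_entries322 T), dirichletTerm, cells_322, Finset.prod_map]
    refine Finset.prod_congr rfl fun k _ => ?_
    fin_cases k <;> rfl
  · intro n hn
    by_contra h
    exact hn (if_neg fun h' => h (exists_entries322_eq h'))

/-- The indicator of the tableaux of shape `(3,2,2)` minus the combination of indicators of
products of chains that appears in `F322`. -/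
def defect322 (a b c d e f g : ℕ+) : ℤ :=
  (if (a ≤ b ∧ b ≤ c) ∧ d ≤ e ∧ f ≤ g ∧ a < d ∧ d < f ∧ b < e ∧ e < g then 1 else 0)
    - (if (a ≤ b ∧ b ≤ c) ∧ d ≤ e ∧ f ≤ g then 1 else 0)
    + (if (a ≤ b ∧ b ≤ c) ∧ f ≤ g ∧ g ≤ e then 1 else 0)
    + (if (d ≤ e ∧ e ≤ b ∧ b ≤ c) ∧ f ≤ g then 1 else 0)
    - (if f ≤ g ∧ g ≤ e ∧ e ≤ b ∧ b ≤ c then 1 else 0)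
    - (if (d ≤ a ∧ a ≤ b ∧ b ≤ c) ∧ f ≤ g ∧ g ≤ e then 1 else 0)
    + (if d ≤ a ∧ f ≤ g ∧ g ≤ e ∧ e ≤ b ∧ b ≤ c then 1 else 0)

set_option maxHeartbeats 1000000 in
theorem defect322_add_swaps (a b c d e f g : ℕ+) :
    defect322 a b c d e f g + defect322 e b c d a f g + defect322 a b c g e f d +
      defect322 e b c g a f d = 0 := by
  simp only [defect322, ← not_le]
  by_cases bc : b ≤ c
  swap
  · simp [bc]
  by_cases fg : f ≤ g <;> by_cases fd : f ≤ d <;> by_cases ab : a ≤ b <;> by_cases eb : e ≤ b <;>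
    simp only [bc, fg, fd, ab, eb, and_true, true_and, false_and, and_false, not_true,
      not_false_eq_true, if_false] <;>
    first
    | rfl
    | by_cases da : d ≤ a <;> by_cases de : d ≤ e <;> by_cases ga : g ≤ a <;> by_cases ge : g ≤ e <;>
        first
        | (simp [da, de, ga, ge]; done)
        | (exfalso; order)

theorem MZSV_nil : MZSV [] = 1 := by
  rw [MZSV_eq_tsum_starTerm (k := 0) [] ![] rfl, tsum_fintype]
  simp [starTerm, dirichletTerm, Subsingleton.monotone]

/-- A product of three zeta-star values whose arguments together use every letter of a filling
exactly once is a sum over all assignments of positive integers to the letters. -/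
theorem hasSum_MZSV_mul_mul {k l m N : ℕ} {s : Fin N → ℂ} {p : Fin k → Fin N} {q : Fin l → Fin N}
    {r : Fin m → Fin N} (hb : Function.Bijective (Sum.elim p (Sum.elim q r)))
    (hp : Summable fun n => ‖starTerm (s ∘ p) n‖) (hq : Summable fun n => ‖starTerm (s ∘ q) n‖)
    (hr : Summable fun n => ‖starTerm (s ∘ r) n‖) {P : (Fin N → ℕ+) → Prop} [DecidablePred P]
    (hP : ∀ n, P n ↔ Monotone (n ∘ p) ∧ Monotone (n ∘ q) ∧ Monotone (n ∘ r)) :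
    HasSum (fun n => if P n then dirichletTerm s n else 0)
      (MZSV (List.ofFn (s ∘ p)) * (MZSV (List.ofFn (s ∘ q)) * MZSV (List.ofFn (s ∘ r)))) := by
  rw [MZSV_eq_tsum_starTerm _ _ rfl, MZSV_eq_tsum_starTerm _ _ rfl, MZSV_eq_tsum_starTerm _ _ rfl]
  refine (hasSum_mul_mul_arrow hp hq hr hb).congr_fun fun n => ?_
  have hprod : dirichletTerm s n = dirichletTerm (s ∘ p) (n ∘ p) *
      (dirichletTerm (s ∘ q) (n ∘ q) * dirichletTerm (s ∘ r) (n ∘ r)) := by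
    simp only [dirichletTerm]
    rw [← (Equiv.ofBijective _ hb).prod_comp, Fintype.prod_sum_type, Fintype.prod_sum_type]
    rfl
  by_cases h : P n
  · obtain ⟨h1, h2, h3⟩ := (hP n).1 h
    simp only [starTerm, if_pos, h, h1, h2, h3, hprod]
  · rw [if_neg h]
    rw [hP n] at h
    simp only [starTerm, ite_mul, mul_ite, zero_mul, mul_zero, ← ite_and]
    rw [if_neg (by tauto)]

theorem hasSum_defect322 (s : Fin 7 → ℂ) (h0 : 1 < (s 0).re) (h1 : 1 ≤ (s 1).re)
    (h2 : 1 < (s 2).re) (h3 : 1 < (s 3).re) (h4 : 1 < (s 4).re) (h5 : 1 ≤ (s 5).re)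
    (h6 : 1 < (s 6).re) :
    HasSum (fun n : Fin 7 → ℕ+ =>
        (defect322 (n 0) (n 1) (n 2) (n 3) (n 4) (n 5) (n 6) : ℂ) * dirichletTerm s n)
      (Z322 (s 0) (s 1) (s 2) (s 3) (s 4) (s 5) (s 6) -
        F322 (s 0) (s 1) (s 2) (s 3) (s 4) (s 5) (s 6)) := by
  have h (i) : 1 ≤ (s i).re := by fin_cases i <;> first | assumption | exact le_of_lt ‹_›
  have H {k : ℕ} (p : Fin (k + 1) → Fin 7) (hp : 1 < (s (p (Fin.last k))).re) :
      Summable fun n => ‖starTerm (s ∘ p) n‖ :=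
    summable_norm_starTerm _ (fun i => h (p i)) hp
  have HE : Summable fun n => ‖starTerm (s ∘ (![] : Fin 0 → Fin 7)) n‖ := Summable.of_finite
  have t1 := hasSum_MZSV_mul_mul (s := s) (p := ![0, 1, 2]) (q := ![3, 4]) (r := ![5, 6])
    (P := fun n => (n 0 ≤ n 1 ∧ n 1 ≤ n 2) ∧ n 3 ≤ n 4 ∧ n 5 ≤ n 6)
    (by decide) (H _ h2) (H _ h4) (H _ h6)
    (fun n => by simp [Fin.monotone_iff_le_succ, Fin.forall_fin_succ])
  have t2 := hasSum_MZSV_mul_mul (s := s) (p := ![0, 1, 2]) (q := ![5, 6, 4]) (r := ![3])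
    (P := fun n => (n 0 ≤ n 1 ∧ n 1 ≤ n 2) ∧ n 5 ≤ n 6 ∧ n 6 ≤ n 4)
    (by decide) (H _ h2) (H _ h4) (H _ h3)
    (fun n => by simp [Fin.monotone_iff_le_succ, Fin.forall_fin_succ])
  have t3 := hasSum_MZSV_mul_mul (s := s) (p := ![3, 4, 1, 2]) (q := ![5, 6]) (r := ![0])
    (P := fun n => (n 3 ≤ n 4 ∧ n 4 ≤ n 1 ∧ n 1 ≤ n 2) ∧ n 5 ≤ n 6)
    (by decide) (H _ h2) (H _ h6) (H _ h0)
    (fun n => by simp [Fin.monotone_iff_le_succ, Fin.forall_fin_succ])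
  have t4 := hasSum_MZSV_mul_mul (s := s) (p := ![5, 6, 4, 1, 2]) (q := ![0]) (r := ![3])
    (P := fun n => n 5 ≤ n 6 ∧ n 6 ≤ n 4 ∧ n 4 ≤ n 1 ∧ n 1 ≤ n 2)
    (by decide) (H _ h2) (H _ h0) (H _ h3)
    (fun n => by simp [Fin.monotone_iff_le_succ, Fin.forall_fin_succ])
  have t5 := hasSum_MZSV_mul_mul (s := s) (p := ![3, 0, 1, 2]) (q := ![5, 6, 4]) (r := ![])
    (P := fun n => (n 3 ≤ n 0 ∧ n 0 ≤ n 1 ∧ n 1 ≤ n 2) ∧ n 5 ≤ n 6 ∧ n 6 ≤ n 4)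
    (by decide) (H _ h2) (H _ h4) HE
    (fun n => by simp [Fin.monotone_iff_le_succ, Fin.forall_fin_succ, Subsingleton.monotone])
  have t6 := hasSum_MZSV_mul_mul (s := s) (p := ![3, 0]) (q := ![5, 6, 4, 1, 2]) (r := ![])
    (P := fun n => n 3 ≤ n 0 ∧ n 5 ≤ n 6 ∧ n 6 ≤ n 4 ∧ n 4 ≤ n 1 ∧ n 1 ≤ n 2)
    (by decide) (H _ h0) (H _ h2) HE
    (fun n => by simp [Fin.monotone_iff_le_succ, Fin.forall_fin_succ, Subsingleton.monotone])
  have tZ : HasSum (fun n => if (n 0 ≤ n 1 ∧ n 1 ≤ n 2) ∧ n 3 ≤ n 4 ∧ n 5 ≤ n 6 ∧ n 0 < n 3 ∧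
      n 3 < n 5 ∧ n 1 < n 4 ∧ n 4 < n 6 then dirichletTerm s n else 0)
      (Z322 (s 0) (s 1) (s 2) (s 3) (s 4) (s 5) (s 6)) := by
    have hs := t1.summable.norm.of_norm_bounded (f := fun n : Fin 7 → ℕ+ =>
        if (n 0 ≤ n 1 ∧ n 1 ≤ n 2) ∧ n 3 ≤ n 4 ∧ n 5 ≤ n 6 ∧ n 0 < n 3 ∧
          n 3 < n 5 ∧ n 1 < n 4 ∧ n 4 < n 6 then dirichletTerm s n else 0) fun n => by
      split_ifs with hT hR
      · rfl
      · exact absurd ⟨hT.1, hT.2.1, hT.2.2.1⟩ hR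
      all_goals simp
    rw [Z322_eq_tsum]
    exact hs.hasSum
  have key := ((((((tZ.sub t1).add t2).add t3).sub t4).sub t5).add t6).congr_fun
    (g := fun n : Fin 7 → ℕ+ =>
      (defect322 (n 0) (n 1) (n 2) (n 3) (n 4) (n 5) (n 6) : ℂ) * dirichletTerm s n) fun n => by
    simp only [defect322]
    push_cast
    simp only [add_mul, sub_mul, ite_mul, one_mul, zero_mul]
  convert key using 1
  · rfl
  · simp only [F322, Matrix.det_fin_three]
    simp [List.ofFn_succ, MZSV_nil]
    ring

theorem hasSum_mul_dirichletTerm_comp_perm (σ : Equiv.Perm (Fin 7)) (s : Fin 7 → ℂ) {x : ℂ}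
    {χ : (Fin 7 → ℕ+) → ℂ}
    (h : HasSum (fun n => χ n * dirichletTerm (s ∘ σ) n) x) :
    HasSum (fun n => χ (n ∘ σ) * dirichletTerm s n) x := by
  rw [← (σ.arrowCongr (Equiv.refl ℕ+)).symm.hasSum_iff] at h
  convert h using 2 with n
  simp only [Function.comp_apply, dirichletTerm]
  congr 1
  exact (Equiv.prod_comp σ _).symm

/-- the extended Jacobi–Trudi formula for shape `(3,2,2)`, summed over the
four diagonal swaps (keeping or exchanging `(s₁₁, s₂₂)` and keeping or exchanging
`(s₂₁, s₃₂)`). -/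
theorem stmt2 (s11 s12 s13 s21 s22 s31 s32 : ℂ)
    (h12 : 1 ≤ s12.re) (h31 : 1 ≤ s31.re)
    (h11 : 1 < s11.re) (h13 : 1 < s13.re) (h21 : 1 < s21.re) (h22 : 1 < s22.re)
    (h32 : 1 < s32.re) :
    Z322 s11 s12 s13 s21 s22 s31 s32 + Z322 s22 s12 s13 s21 s11 s31 s32
      + Z322 s11 s12 s13 s32 s22 s31 s21 + Z322 s22 s12 s13 s32 s11 s31 s21
    = F322 s11 s12 s13 s21 s22 s31 s32 + F322 s22 s12 s13 s21 s11 s31 s32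
      + F322 s11 s12 s13 s32 s22 s31 s21 + F322 s22 s12 s13 s32 s11 s31 s21 := by
  let s : Fin 7 → ℂ := ![s11, s12, s13, s21, s22, s31, s32]
  have t1 := hasSum_defect322 s h11 h12 h13 h21 h22 h31 h32
  have t2 := hasSum_mul_dirichletTerm_comp_perm (Equiv.swap 0 4) s
    (hasSum_defect322 (s ∘ Equiv.swap 0 4) h22 h12 h13 h21 h11 h31 h32)
  have t3 := hasSum_mul_dirichletTerm_comp_perm (Equiv.swap 3 6) s
    (hasSum_defect322 (s ∘ Equiv.swap 3 6) h11 h12 h13 h32 h22 h31 h21)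
  have t4 := hasSum_mul_dirichletTerm_comp_perm ((Equiv.swap 0 4).trans (Equiv.swap 3 6)) s
    (hasSum_defect322 (s ∘ (Equiv.swap 0 4).trans (Equiv.swap 3 6))
      h22 h12 h13 h32 h11 h31 h21)
  have key := (((t1.add t2).add t3).add t4).unique (hasSum_zero.congr_fun fun n => ?_)
  · change Z322 s11 s12 s13 s21 s22 s31 s32 - F322 s11 s12 s13 s21 s22 s31 s32 +
      (Z322 s22 s12 s13 s21 s11 s31 s32 - F322 s22 s12 s13 s21 s11 s31 s32) +
      (Z322 s11 s12 s13 s32 s22 s31 s21 - F322 s11 s12 s13 s32 s22 s31 s21) +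
      (Z322 s22 s12 s13 s32 s11 s31 s21 - F322 s22 s12 s13 s32 s11 s31 s21) = 0 at key
    linear_combination key
  · rw [← add_mul, ← add_mul, ← add_mul]
    have := defect322_add_swaps (n 0) (n 1) (n 2) (n 3) (n 4) (n 5) (n 6)
    have hz : ∀ x y z w : ℤ, x + y + z + w = 0 → (x + y + z + w : ℂ) = 0 := by
      exact_mod_cast fun x y z w h => h
    refine mul_eq_zero_of_left (hz _ _ _ _ this) _
end

section
/- Let a, b, c, d be complex numbers with Re(a) > 1, Re(b) > 1, Re(c) > 1 and Re(d) > 1. Then ζ⋆(a,b)·ζ⋆(c,d) − ζ⋆(a)·ζ⋆(c,d,b) + ζ⋆(d,b)·ζ⋆(c,a) − ζ⋆(d)·ζ⋆(c,a,b) = ζ(a,c)·ζ(b,d) − ζ(a)·ζ(b,d,c) + ζ(d,c)·ζ(b,a) − ζ(d)·ζ(b,a,c). -/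
open scoped BigOperators

/-- Dirichlet monomials of exponent with real part greater than `1` are absolutely summable. -/
lemma summable_norm_pnat_cpow {s : ℂ} (hs : 1 < s.re) :
    Summable fun n : ℕ+ => ‖(n : ℂ) ^ (-s)‖ := by
  have h : Summable fun n : ℕ => ‖1 / (n : ℂ) ^ s‖ :=
    (Complex.summable_one_div_nat_cpow.mpr hs).norm
  refine (h.comp_injective PNat.coe_injective).congr fun n => ?_
  simp [Complex.cpow_neg]

/-- The evaluation equivalence between functions on `Fin 3` and triples. -/
def finThreeArrowEquivProd (α : Type*) : (Fin 3 → α) ≃ α × α × α where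
  toFun f := (f 0, f 1, f 2)
  invFun p := ![p.1, p.2.1, p.2.2]
  left_inv f := by
    funext i
    fin_cases i <;> rfl
  right_inv _ := rfl

lemma finThreeArrowEquivProd_apply {α : Type*} (f : Fin 3 → α) :
    finThreeArrowEquivProd α f = (f 0, f 1, f 2) := rfl

lemma finThreeArrowEquivProd_symm_apply {α : Type*} (p : α × α × α) :
    (finThreeArrowEquivProd α).symm p = ![p.1, p.2.1, p.2.2] := rfl

lemma tsum_fin_one_subtype (P : (Fin 1 → ℕ+) → Prop) (hP : ∀ f, P f) (g : (Fin 1 → ℕ+) → ℂ) :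
    ∑' n : {f // P f}, g n.1 = ∑' n : ℕ+, g fun _ => n := by
  rw [← ((Equiv.funUnique (Fin 1) ℕ+).symm.trans (Equiv.subtypeUnivEquiv hP).symm).tsum_eq]
  rfl

lemma tsum_subtype_eq_tsum_ite_comp_symm {α β : Type*} (e : α ≃ β) (P : α → Prop)
    (Q : β → Prop) [DecidablePred Q] (hPQ : ∀ x, P x ↔ Q (e x)) (g : α → ℂ) :
    ∑' x : {x // P x}, g x.1 = ∑' y, if Q y then g (e.symm y) else 0 := by
  classical
  have h := tsum_subtype {x | P x} g
  refine h.trans ?_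
  rw [← e.tsum_eq]
  refine tsum_congr fun x => ?_
  simp [Set.indicator_apply, hPQ]

lemma MZSV_singleton (a : ℂ) : MZSV [a] = ∑' n : ℕ+, (n : ℂ) ^ (-a) := by
  refine (tsum_fin_one_subtype Monotone (fun f => Subsingleton.monotone f)
    (fun f => ∏ i : Fin 1, (f i : ℂ) ^ (-([a].get i)))).trans ?_
  simp

lemma MZV_singleton (a : ℂ) : MZV [a] = ∑' n : ℕ+, (n : ℂ) ^ (-a) := by
  refine (tsum_fin_one_subtype StrictMono (fun f => Subsingleton.strictMono f)
    (fun f => ∏ i : Fin 1, (f i : ℂ) ^ (-([a].get i)))).trans ?_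
  simp

lemma MZSV_pair (a b : ℂ) : MZSV [a, b] =
    ∑' p : ℕ+ × ℕ+, if p.1 ≤ p.2 then (p.1 : ℂ) ^ (-a) * (p.2 : ℂ) ^ (-b) else 0 := by
  refine (tsum_subtype_eq_tsum_ite_comp_symm (finTwoArrowEquiv ℕ+) Monotone
    (fun p => p.1 ≤ p.2) (fun f => ?_)
    (fun f => ∏ i : Fin 2, (f i : ℂ) ^ (-([a, b].get i)))).trans ?_
  · simp [Fin.monotone_iff_le_succ]
  · simp [Fin.prod_univ_two]

lemma MZV_pair (a b : ℂ) : MZV [a, b] =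
    ∑' p : ℕ+ × ℕ+, if p.1 < p.2 then (p.1 : ℂ) ^ (-a) * (p.2 : ℂ) ^ (-b) else 0 := by
  refine (tsum_subtype_eq_tsum_ite_comp_symm (finTwoArrowEquiv ℕ+) StrictMono
    (fun p => p.1 < p.2) (fun f => ?_)
    (fun f => ∏ i : Fin 2, (f i : ℂ) ^ (-([a, b].get i)))).trans ?_
  · simp [Fin.strictMono_iff_lt_succ]
  · simp [Fin.prod_univ_two]

lemma MZSV_triple (a b c : ℂ) : MZSV [a, b, c] =
    ∑' p : ℕ+ × ℕ+ × ℕ+, if p.1 ≤ p.2.1 ∧ p.2.1 ≤ p.2.2 then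
      (p.1 : ℂ) ^ (-a) * (p.2.1 : ℂ) ^ (-b) * (p.2.2 : ℂ) ^ (-c) else 0 := by
  refine (tsum_subtype_eq_tsum_ite_comp_symm (finThreeArrowEquivProd ℕ+) Monotone
    (fun p => p.1 ≤ p.2.1 ∧ p.2.1 ≤ p.2.2) (fun f => ?_)
    (fun f => ∏ i : Fin 3, (f i : ℂ) ^ (-([a, b, c].get i)))).trans ?_
  · simp [Fin.monotone_iff_le_succ, Fin.forall_fin_two, finThreeArrowEquivProd_apply]
  · simp [Fin.prod_univ_three, finThreeArrowEquivProd_symm_apply]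

lemma MZV_triple (a b c : ℂ) : MZV [a, b, c] =
    ∑' p : ℕ+ × ℕ+ × ℕ+, if p.1 < p.2.1 ∧ p.2.1 < p.2.2 then
      (p.1 : ℂ) ^ (-a) * (p.2.1 : ℂ) ^ (-b) * (p.2.2 : ℂ) ^ (-c) else 0 := by
  refine (tsum_subtype_eq_tsum_ite_comp_symm (finThreeArrowEquivProd ℕ+) StrictMono
    (fun p => p.1 < p.2.1 ∧ p.2.1 < p.2.2) (fun f => ?_)
    (fun f => ∏ i : Fin 3, (f i : ℂ) ^ (-([a, b, c].get i)))).trans ?_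
  · simp [Fin.strictMono_iff_lt_succ, Fin.forall_fin_two, finThreeArrowEquivProd_apply]
  · simp [Fin.prod_univ_three, finThreeArrowEquivProd_symm_apply]

lemma Summable.norm_ite_zero {α : Type*} {f : α → ℂ} (hf : Summable fun x => ‖f x‖)
    (P : α → Prop) [DecidablePred P] : Summable fun x => ‖if P x then f x else 0‖ := by
  refine Summable.of_nonneg_of_le (fun _ => norm_nonneg _) (fun x => ?_) hf
  split_ifs <;> simp

section FourfoldSums

variable {f g h k : ℕ+ → ℂ}

lemma hasSum_pair_mul_pair {α : Type*} (hf : Summable fun n => ‖f n‖)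
    (hg : Summable fun n => ‖g n‖) (hh : Summable fun n => ‖h n‖) (hk : Summable fun n => ‖k n‖)
    (R : ℕ+ → ℕ+ → Prop) [∀ x y, Decidable (R x y)]
    (e : α ≃ (ℕ+ × ℕ+) × (ℕ+ × ℕ+)) :
    HasSum (fun q => if R (e q).1.1 (e q).1.2 ∧ R (e q).2.1 (e q).2.2 then
        f (e q).1.1 * g (e q).1.2 * h (e q).2.1 * k (e q).2.2 else 0)
      ((∑' p : ℕ+ × ℕ+, if R p.1 p.2 then f p.1 * g p.2 else 0) *
        ∑' p : ℕ+ × ℕ+, if R p.1 p.2 then h p.1 * k p.2 else 0) := by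
  have h1 := (hf.mul_norm hg).norm_ite_zero (fun p => R p.1 p.2)
  have h2 := (hh.mul_norm hk).norm_ite_zero (fun p => R p.1 p.2)
  rw [tsum_mul_tsum_of_summable_norm h1 h2]
  simpa only [Function.comp_def, ite_zero_mul_ite_zero, mul_assoc] using
    e.hasSum_iff.mpr (summable_mul_of_summable_norm h1 h2).hasSum

lemma hasSum_single_mul_triple {α : Type*} (hf : Summable fun n => ‖f n‖)
    (hg : Summable fun n => ‖g n‖) (hh : Summable fun n => ‖h n‖) (hk : Summable fun n => ‖k n‖)
    (R : ℕ+ → ℕ+ → Prop) [∀ x y, Decidable (R x y)]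
    (e : α ≃ ℕ+ × (ℕ+ × ℕ+ × ℕ+)) :
    HasSum (fun q => if R (e q).2.1 (e q).2.2.1 ∧ R (e q).2.2.1 (e q).2.2.2 then
        f (e q).1 * g (e q).2.1 * h (e q).2.2.1 * k (e q).2.2.2 else 0)
      ((∑' n, f n) * ∑' p : ℕ+ × ℕ+ × ℕ+, if R p.1 p.2.1 ∧ R p.2.1 p.2.2 then
        g p.1 * h p.2.1 * k p.2.2 else 0) := by
  have h2 : Summable fun p : ℕ+ × ℕ+ × ℕ+ => ‖g p.1 * h p.2.1 * k p.2.2‖ := by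
    simpa only [mul_assoc] using hg.mul_norm (hh.mul_norm hk)
  have h2 := h2.norm_ite_zero (fun p => R p.1 p.2.1 ∧ R p.2.1 p.2.2)
  rw [tsum_mul_tsum_of_summable_norm hf h2]
  simpa only [Function.comp_def, mul_ite, mul_zero, mul_assoc] using
    e.hasSum_iff.mpr (summable_mul_of_summable_norm hf h2).hasSum

end FourfoldSums

/-- an identity between multiple zeta-star values and multiple zeta values
coming from the two Jacobi–Trudi expressions for the shape `(2,2)`. -/
theorem stmt5 (a b c d : ℂ) (ha : 1 < a.re) (hb : 1 < b.re) (hc : 1 < c.re)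
    (hd : 1 < d.re) :
    MZSV [a, b] * MZSV [c, d] - MZSV [a] * MZSV [c, d, b]
      + MZSV [d, b] * MZSV [c, a] - MZSV [d] * MZSV [c, a, b]
    = MZV [a, c] * MZV [b, d] - MZV [a] * MZV [b, d, c]
      + MZV [d, c] * MZV [b, a] - MZV [d] * MZV [b, a, c] := by
  have ha := summable_norm_pnat_cpow ha
  have hb := summable_norm_pnat_cpow hb
  have hc := summable_norm_pnat_cpow hc
  have hd := summable_norm_pnat_cpow hd
  simp only [MZSV_singleton, MZV_singleton, MZSV_pair, MZV_pair, MZSV_triple, MZV_triple]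
  -- The variables `w, x, y, z` of a quadruple are attached to `a, b, c, d` respectively.
  have L := (((hasSum_pair_mul_pair ha hb hc hd (· ≤ ·)
      ⟨fun (w, x, y, z) => ((w, x), (y, z)), fun ((w, x), (y, z)) => (w, x, y, z),
        fun _ => rfl, fun _ => rfl⟩).sub
    (hasSum_single_mul_triple ha hc hd hb (· ≤ ·)
      ⟨fun (w, x, y, z) => (w, y, z, x), fun (w, y, z, x) => (w, x, y, z),
        fun _ => rfl, fun _ => rfl⟩)).add
    (hasSum_pair_mul_pair hd hb hc ha (· ≤ ·)
      ⟨fun (w, x, y, z) => ((z, x), (y, w)), fun ((z, x), (y, w)) => (w, x, y, z),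
        fun _ => rfl, fun _ => rfl⟩)).sub
    (hasSum_single_mul_triple hd hc ha hb (· ≤ ·)
      ⟨fun (w, x, y, z) => (z, y, w, x), fun (z, y, w, x) => (w, x, y, z),
        fun _ => rfl, fun _ => rfl⟩)
  have M := (((hasSum_pair_mul_pair ha hc hb hd (· < ·)
      ⟨fun (w, x, y, z) => ((w, y), (x, z)), fun ((w, y), (x, z)) => (w, x, y, z),
        fun _ => rfl, fun _ => rfl⟩).sub
    (hasSum_single_mul_triple ha hb hd hc (· < ·)
      ⟨fun (w, x, y, z) => (w, x, z, y), fun (w, x, z, y) => (w, x, y, z),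
        fun _ => rfl, fun _ => rfl⟩)).add
    (hasSum_pair_mul_pair hd hc hb ha (· < ·)
      ⟨fun (w, x, y, z) => ((z, y), (x, w)), fun ((z, y), (x, w)) => (w, x, y, z),
        fun _ => rfl, fun _ => rfl⟩)).sub
    (hasSum_single_mul_triple hd hb ha hc (· < ·)
      ⟨fun (w, x, y, z) => (z, x, w, y), fun (z, x, w, y) => (w, x, y, z),
        fun _ => rfl, fun _ => rfl⟩)
  refine L.unique ?_
  convert M using 1
  funext ⟨w, x, y, z⟩
  simp only [Equiv.coe_fn_mk]
  generalize (w : ℂ) ^ (-a) = A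
  generalize (x : ℂ) ^ (-b) = B
  generalize (y : ℂ) ^ (-c) = C
  generalize (z : ℂ) ^ (-d) = D
  simp only [← not_le]
  by_cases hwx : w ≤ x <;> by_cases hyz : y ≤ z <;> by_cases hzx : z ≤ x <;>
    by_cases hyw : y ≤ w <;>
    simp only [hwx, hyz, hzx, hyw, and_true, and_false, not_true, not_false_iff, if_true,
      if_false] <;> ring1
end

section
/- Let k ≥ 1 be an integer and let a, y, z be complex numbers with Re(a) > 1, Re(y) > 1 and Re(z) > 1. Write a^{(j)} for a repeated j times (the empty tuple when j = 0, with ζ of the empty tuple equal to 1). Then ζ(a^{(k)})·ζ(y)·ζ(a^{(k−1)}, z) − ζ(y, a^{(k)})·ζ(a^{(k−1)}, z) = Σ_{ℓ=k}^{2k−1} { det[[ζ(a^{(ℓ−1)}, z), ζ(a^{(ℓ)}, z), ζ(y, a^{(ℓ)}, z)], [ζ(a^{(2k−1−ℓ)}), ζ(a^{(2k−ℓ)}), ζ(y, a^{(2k−ℓ)})], [0, 1, ζ(y)]] + det[[ζ(a^{(ℓ)}, z), ζ(y, a^{(ℓ)}, z)], [ζ(a^{(2k−1−ℓ)}), ζ(y,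 a^{(2k−1−ℓ)})]] }. -/
open scoped BigOperators

/-- The multiple zeta value of the empty tuple is `1`. -/
theorem MZV_nil : MZV [] = 1 := by
  have : Unique {f : Fin ([] : List ℂ).length → ℕ+ // StrictMono f} :=
    { default := ⟨fun i => Fin.elim0 i, fun i => Fin.elim0 i⟩
      uniq := fun f => Subtype.ext (funext fun i => Fin.elim0 i) }
  rw [MZV, tsum_eq_single default (fun b hb => absurd (Subsingleton.elim b default) hb)]
  exact Fin.prod_univ_zero _

/-- the determinant identity behind the Pieri-type formula
`(2,1^{k-1}) · (1^k)` with constant diagonal entries `a`. -/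
theorem stmt6 (k : ℕ) (hk : 1 ≤ k) (a y z : ℂ) (ha : 1 < a.re) (hy : 1 < y.re)
    (hz : 1 < z.re) :
    MZV (List.replicate k a) * MZV [y] * MZV (List.replicate (k - 1) a ++ [z])
      - MZV (y :: List.replicate k a) * MZV (List.replicate (k - 1) a ++ [z])
    = ∑ l ∈ Finset.Icc k (2 * k - 1),
        (Matrix.det !![MZV (List.replicate (l - 1) a ++ [z]),
              MZV (List.replicate l a ++ [z]),
              MZV (y :: (List.replicate l a ++ [z]));
            MZV (List.replicate (2 * k - 1 - l) a),
              MZV (List.replicate (2 * k - l) a),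
              MZV (y :: List.replicate (2 * k - l) a);
            0, 1, MZV [y]]
          + Matrix.det !![MZV (List.replicate l a ++ [z]),
                MZV (y :: (List.replicate l a ++ [z]));
              MZV (List.replicate (2 * k - 1 - l) a),
                MZV (y :: List.replicate (2 * k - 1 - l) a)]) := by
  obtain ⟨m, rfl⟩ : ∃ m, k = m + 1 := ⟨k - 1, by omega⟩
  -- With `l` replaced by `l - 1`, the `l`-th summand is `F l - F (l + 1)`.
  let F : ℕ → ℂ := fun l =>
    MZV (List.replicate (l - 1) a ++ [z]) *
      (MZV (List.replicate (2 * (m + 1) - l) a) * MZV [y]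
        - MZV (y :: List.replicate (2 * (m + 1) - l) a))
  have hIcc : Finset.Icc (m + 1) (2 * (m + 1) - 1) = Finset.Ico (m + 1) (2 * (m + 1)) := by
    ext l
    simp only [Finset.mem_Icc, Finset.mem_Ico]
    omega
  have hlast : F (2 * (m + 1)) = 0 := by
    simp [F, MZV_nil]
  have htel := Finset.sum_Ico_sub F (show m + 1 ≤ 2 * (m + 1) by omega)
  have hfirst : F (m + 1) = MZV (List.replicate m a ++ [z]) *
      (MZV (List.replicate (m + 1) a) * MZV [y] - MZV (y :: List.replicate (m + 1) a)) := by
    simp only [F, show 2 * (m + 1) - (m + 1) = m + 1 by omega, Nat.add_sub_cancel]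
  rw [hIcc]
  trans -∑ l ∈ Finset.Ico (m + 1) (2 * (m + 1)), (F (l + 1) - F l)
  · rw [htel, hlast, hfirst, Nat.add_sub_cancel]
    ring
  · rw [← Finset.sum_neg_distrib]
    refine Finset.sum_congr rfl fun l _ => ?_
    simp only [F, Nat.add_sub_cancel, show 2 * (m + 1) - (l + 1) = 2 * (m + 1) - 1 - l by omega]
    rw [Matrix.det_fin_three, Matrix.det_fin_two_of]
    simp only [Matrix.of_apply, Matrix.cons_val]
    ring
end

section
/- Let a, y, z be complex numbers with Re(a) > 1, Re(y) > 1 and Re(z) > 1. Then ζ_{(2,1)}(rows (a,y), (a)) · ζ(a, z) = ζ_{(2,1,1,1)}(rows (a,y), (a), (a), (z)) + ζ_{(2,2,1)}(rows (a,y), (a,a), (z)) + ζ_{(3,1,1)}(rows (a,a,y), (a), (z)) + ζ_{(3,2)}(rows (a,a,y), (z,a)). -/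
open scoped BigOperators

/-- The summand `(n + 1)^{-s}` of the Riemann zeta function, indexed from `0`. -/
noncomputable def zetaTerm (s : ℂ) (n : ℕ) : ℂ := ((n + 1 : ℕ) : ℂ) ^ (-s)

lemma summable_norm_zetaTerm {s : ℂ} (hs : 1 < s.re) : Summable fun n => ‖zetaTerm s n‖ := by
  have h := (summable_nat_add_iff 1).2 (Real.summable_nat_rpow_inv.2 hs)
  refine h.congr fun n => ?_
  rw [zetaTerm, Complex.norm_natCast_cpow_of_pos n.succ_pos, Complex.neg_re,
    Real.rpow_neg (Nat.cast_nonneg _)]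

lemma mem_ofRowLens_iff_lt_getD {w : List ℕ} {hw : w.SortedGE} {i j : ℕ} :
    (i, j) ∈ YoungDiagram.ofRowLens w hw ↔ j < w.getD i 0 := by
  rw [YoungDiagram.mem_ofRowLens]
  by_cases h : i < w.length <;> simp [h]

lemma tsum_comp_eq_tsum_indicator {ι X : Type*} {e : ι → X} (he : Function.Injective e)
    {P : Set X} (hP : Set.range e = P) (F : X → ℂ) :
    ∑' i, F (e i) = ∑' x, P.indicator F x := by
  rw [← tsum_range F he, tsum_subtype, hP]

namespace SemistandardYoungTableau

lemma ext_of_mem {μ : YoungDiagram} {T T' : SemistandardYoungTableau μ}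
    (h : ∀ c ∈ μ.cells, T c.1 c.2 = T' c.1 c.2) : T = T' := by
  ext i j
  by_cases hc : (i, j) ∈ μ
  · exact h (i, j) hc
  · rw [T.zeros hc, T'.zeros hc]

lemma exists_eq_on_cells {μ : YoungDiagram} (f : ℕ → ℕ → ℕ)
    (hrow : ∀ c ∈ μ.cells, ∀ j < c.2, f c.1 j ≤ f c.1 c.2)
    (hcol : ∀ c ∈ μ.cells, ∀ i < c.1, f i c.2 < f c.1 c.2) :
    ∃ T : SemistandardYoungTableau μ, ∀ c ∈ μ.cells, T c.1 c.2 = f c.1 c.2 := by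
  classical
  refine ⟨⟨fun i j => if (i, j) ∈ μ then f i j else 0, ?_, ?_, ?_⟩, ?_⟩
  · intro i j₁ j₂ hj hc
    simpa only [if_pos hc, if_pos (μ.up_left_mem le_rfl hj.le hc)] using hrow (i, j₂) hc j₁ hj
  · intro i₁ i₂ j hi hc
    simpa only [if_pos hc, if_pos (μ.up_left_mem hi.le le_rfl hc)] using hcol (i₂, j) hc i₁ hi
  · intro i j hc
    exact if_neg hc
  · rintro ⟨i, j⟩ hc
    exact if_pos hc

end SemistandardYoungTableau

section Expansions

variable (a y z : ℂ)

/-- The summand of the `(2, 1)` hook, as a function of the entries `(p, r, q)` at the corner,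
the leg and the arm. -/
noncomputable def hookTerm (v : ℕ × ℕ × ℕ) : ℂ :=
  zetaTerm a v.1 * zetaTerm a v.2.1 * zetaTerm y v.2.2

/-- The summand of the double zeta value `ζ(a, z)`. -/
noncomputable def pairTerm (v : ℕ × ℕ) : ℂ := zetaTerm a v.1 * zetaTerm z v.2

/-- The common summand of both sides of the Pieri formula at `((p, r, q), (k, l))`: the variables
`p`, `r`, `k` carry the exponent `a`, while `q` carries `y` and `l` carries `z`. -/
noncomputable def pieriTerm (v : (ℕ × ℕ × ℕ) × (ℕ × ℕ)) : ℂ := hookTerm a y v.1 * pairTerm a z v.2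

variable {a y z}

lemma summable_norm_hookTerm (ha : 1 < a.re) (hy : 1 < y.re) :
    Summable fun v => ‖hookTerm a y v‖ := by
  refine ((summable_norm_zetaTerm ha).mul_norm
    ((summable_norm_zetaTerm ha).mul_norm (summable_norm_zetaTerm hy))).congr fun v => ?_
  rw [hookTerm, mul_assoc]

lemma summable_norm_pairTerm (ha : 1 < a.re) (hz : 1 < z.re) :
    Summable fun v => ‖pairTerm a z v‖ :=
  (summable_norm_zetaTerm ha).mul_norm (summable_norm_zetaTerm hz)

lemma summable_pieriTerm (ha : 1 < a.re) (hy : 1 < y.re) (hz : 1 < z.re) :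
    Summable (pieriTerm a y z) :=
  ((summable_norm_hookTerm ha hy).mul_norm (summable_norm_pairTerm ha hz)).of_norm

variable (a y z)

lemma schurZeta_two_one :
    schurZeta (YoungDiagram.ofRowLens [2, 1] (by decide)) (fillOfRows [[a, y], [a]])
      = ∑' v, {v : ℕ × ℕ × ℕ | v.1 ≤ v.2.2 ∧ v.1 < v.2.1}.indicator (hookTerm a y) v := by
  have hcells : (YoungDiagram.ofRowLens [2, 1] (by decide)).cells = {(0, 0), (0, 1), (1, 0)} := by
    decide
  rw [← tsum_comp_eq_tsum_indicator
    (ι := SemistandardYoungTableau (YoungDiagram.ofRowLens [2, 1] (by decide)))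
    (e := fun T => (T 0 0, T 1 0, T 0 1))]
  · refine tsum_congr fun T => ?_
    rw [hcells]
    simp [hookTerm, zetaTerm, fillOfRows]
    ring
  · intro T T' h
    refine SemistandardYoungTableau.ext_of_mem ?_
    rw [hcells]
    simp_all
  · ext ⟨p, r, q⟩
    constructor
    · rintro ⟨T, hT⟩
      simp only [Prod.mk.injEq] at hT
      obtain ⟨rfl, rfl, rfl⟩ := hT
      exact ⟨T.row_weak one_pos (by simp [mem_ofRowLens_iff_lt_getD]),
        T.col_strict one_pos (by simp [mem_ofRowLens_iff_lt_getD])⟩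
    · rintro ⟨h₁, h₂⟩
      dsimp only at h₁ h₂
      obtain ⟨T, hT⟩ := SemistandardYoungTableau.exists_eq_on_cells
        (μ := YoungDiagram.ofRowLens [2, 1] (by decide))
        (fun i j => ([[p, q], [r]].getD i []).getD j 0)
        (by
          rw [hcells]
          intro c hc j hj
          fin_cases hc <;> dsimp at hj ⊢
          all_goals interval_cases j
          all_goals simp
          all_goals omega)
        (by
          rw [hcells]
          intro c hc i hi
          fin_cases hc <;> dsimp at hi ⊢
          all_goals interval_cases i
          all_goals simp
          all_goals omega)
      rw [hcells] at hT
      refine ⟨T, ?_⟩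
      simp_all

lemma schurZeta_two_one_one_one :
    schurZeta (YoungDiagram.ofRowLens [2, 1, 1, 1] (by decide))
        (fillOfRows [[a, y], [a], [a], [z]])
      = ∑' v, {v : (ℕ × ℕ × ℕ) × (ℕ × ℕ) | v.1.1 ≤ v.1.2.2 ∧ v.1.1 < v.1.2.1 ∧ v.1.2.1 < v.2.1 ∧
          v.2.1 < v.2.2}.indicator (pieriTerm a y z) v := by
  have hcells : (YoungDiagram.ofRowLens [2, 1, 1, 1] (by decide)).cells
      = {(0, 0), (0, 1), (1, 0), (2, 0), (3, 0)} := by decide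
  rw [← tsum_comp_eq_tsum_indicator
    (ι := SemistandardYoungTableau (YoungDiagram.ofRowLens [2, 1, 1, 1] (by decide)))
    (e := fun T => ((T 0 0, T 1 0, T 0 1), (T 2 0, T 3 0)))]
  · refine tsum_congr fun T => ?_
    rw [hcells]
    simp [pieriTerm, hookTerm, pairTerm, zetaTerm, fillOfRows]
    ring
  · intro T T' h
    refine SemistandardYoungTableau.ext_of_mem ?_
    rw [hcells]
    simp_all
  · ext ⟨⟨p, r, q⟩, k, l⟩
    constructor
    · rintro ⟨T, hT⟩
      simp only [Prod.mk.injEq] at hT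
      obtain ⟨⟨rfl, rfl, rfl⟩, rfl, rfl⟩ := hT
      exact ⟨T.row_weak one_pos (by simp [mem_ofRowLens_iff_lt_getD]),
        T.col_strict (by decide) (by simp [mem_ofRowLens_iff_lt_getD]),
        T.col_strict (by decide) (by simp [mem_ofRowLens_iff_lt_getD]),
        T.col_strict (by decide) (by simp [mem_ofRowLens_iff_lt_getD])⟩
    · rintro ⟨h₁, h₂, h₃, h₄⟩
      dsimp only at h₁ h₂ h₃ h₄
      obtain ⟨T, hT⟩ := SemistandardYoungTableau.exists_eq_on_cells
        (μ := YoungDiagram.ofRowLens [2, 1, 1, 1] (by decide))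
        (fun i j => ([[p, q], [r], [k], [l]].getD i []).getD j 0)
        (by
          rw [hcells]
          intro c hc j hj
          fin_cases hc <;> dsimp at hj ⊢
          all_goals interval_cases j
          all_goals simp
          all_goals omega)
        (by
          rw [hcells]
          intro c hc i hi
          fin_cases hc <;> dsimp at hi ⊢
          all_goals interval_cases i
          all_goals simp
          all_goals omega)
      rw [hcells] at hT
      refine ⟨T, ?_⟩
      simp_all

lemma schurZeta_two_two_one :
    schurZeta (YoungDiagram.ofRowLens [2, 2, 1] (by decide))
        (fillOfRows [[a, y], [a, a], [z]])
      = ∑' v, {v : (ℕ × ℕ × ℕ) × (ℕ × ℕ) | v.1.1 ≤ v.1.2.2 ∧ v.1.1 < v.1.2.1 ∧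
          v.1.2.1 < v.2.2 ∧ v.1.2.1 ≤ v.2.1 ∧ v.1.2.2 < v.2.1}.indicator (pieriTerm a y z) v := by
  have hcells : (YoungDiagram.ofRowLens [2, 2, 1] (by decide)).cells
      = {(0, 0), (0, 1), (1, 0), (1, 1), (2, 0)} := by decide
  rw [← tsum_comp_eq_tsum_indicator
    (ι := SemistandardYoungTableau (YoungDiagram.ofRowLens [2, 2, 1] (by decide)))
    (e := fun T => ((T 0 0, T 1 0, T 0 1), (T 1 1, T 2 0)))]
  · refine tsum_congr fun T => ?_
    rw [hcells]
    simp [pieriTerm, hookTerm, pairTerm, zetaTerm, fillOfRows]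
    ring
  · intro T T' h
    refine SemistandardYoungTableau.ext_of_mem ?_
    rw [hcells]
    simp_all
  · ext ⟨⟨p, r, q⟩, k, l⟩
    constructor
    · rintro ⟨T, hT⟩
      simp only [Prod.mk.injEq] at hT
      obtain ⟨⟨rfl, rfl, rfl⟩, rfl, rfl⟩ := hT
      exact ⟨T.row_weak one_pos (by simp [mem_ofRowLens_iff_lt_getD]),
        T.col_strict (by decide) (by simp [mem_ofRowLens_iff_lt_getD]),
        T.col_strict (by decide) (by simp [mem_ofRowLens_iff_lt_getD]),
        T.row_weak (by decide) (by simp [mem_ofRowLens_iff_lt_getD]),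
        T.col_strict (by decide) (by simp [mem_ofRowLens_iff_lt_getD])⟩
    · rintro ⟨h₁, h₂, h₃, h₄, h₅⟩
      dsimp only at h₁ h₂ h₃ h₄ h₅
      obtain ⟨T, hT⟩ := SemistandardYoungTableau.exists_eq_on_cells
        (μ := YoungDiagram.ofRowLens [2, 2, 1] (by decide))
        (fun i j => ([[p, q], [r, k], [l]].getD i []).getD j 0)
        (by
          rw [hcells]
          intro c hc j hj
          fin_cases hc <;> dsimp at hj ⊢
          all_goals interval_cases j
          all_goals simp
          all_goals omega)
        (by
          rw [hcells]
          intro c hc i hi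
          fin_cases hc <;> dsimp at hi ⊢
          all_goals interval_cases i
          all_goals simp
          all_goals omega)
      rw [hcells] at hT
      refine ⟨T, ?_⟩
      simp_all

lemma schurZeta_three_one_one :
    schurZeta (YoungDiagram.ofRowLens [3, 1, 1] (by decide))
        (fillOfRows [[a, a, y], [a], [z]])
      = ∑' v, {v : (ℕ × ℕ × ℕ) × (ℕ × ℕ) | v.1.1 ≤ v.2.1 ∧ v.2.1 ≤ v.1.2.2 ∧
          v.1.1 < v.1.2.1 ∧ v.1.2.1 < v.2.2}.indicator (pieriTerm a y z) v := by
  have hcells : (YoungDiagram.ofRowLens [3, 1, 1] (by decide)).cells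
      = {(0, 0), (0, 1), (0, 2), (1, 0), (2, 0)} := by decide
  rw [← tsum_comp_eq_tsum_indicator
    (ι := SemistandardYoungTableau (YoungDiagram.ofRowLens [3, 1, 1] (by decide)))
    (e := fun T => ((T 0 0, T 1 0, T 0 2), (T 0 1, T 2 0)))]
  · refine tsum_congr fun T => ?_
    rw [hcells]
    simp [pieriTerm, hookTerm, pairTerm, zetaTerm, fillOfRows]
    ring
  · intro T T' h
    refine SemistandardYoungTableau.ext_of_mem ?_
    rw [hcells]
    simp_all
  · ext ⟨⟨p, r, q⟩, k, l⟩
    constructor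
    · rintro ⟨T, hT⟩
      simp only [Prod.mk.injEq] at hT
      obtain ⟨⟨rfl, rfl, rfl⟩, rfl, rfl⟩ := hT
      exact ⟨T.row_weak (by decide) (by simp [mem_ofRowLens_iff_lt_getD]),
        T.row_weak (by decide) (by simp [mem_ofRowLens_iff_lt_getD]),
        T.col_strict (by decide) (by simp [mem_ofRowLens_iff_lt_getD]),
        T.col_strict (by decide) (by simp [mem_ofRowLens_iff_lt_getD])⟩
    · rintro ⟨h₁, h₂, h₃, h₄⟩
      dsimp only at h₁ h₂ h₃ h₄
      obtain ⟨T, hT⟩ := SemistandardYoungTableau.exists_eq_on_cells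
        (μ := YoungDiagram.ofRowLens [3, 1, 1] (by decide))
        (fun i j => ([[p, k, q], [r], [l]].getD i []).getD j 0)
        (by
          rw [hcells]
          intro c hc j hj
          fin_cases hc <;> dsimp at hj ⊢
          all_goals interval_cases j
          all_goals simp
          all_goals omega)
        (by
          rw [hcells]
          intro c hc i hi
          fin_cases hc <;> dsimp at hi ⊢
          all_goals interval_cases i
          all_goals simp
          all_goals omega)
      rw [hcells] at hT
      refine ⟨T, ?_⟩
      simp_all

lemma schurZeta_three_two :
    schurZeta (YoungDiagram.ofRowLens [3, 2] (by decide))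
        (fillOfRows [[a, a, y], [z, a]])
      = ∑' v, {v : (ℕ × ℕ × ℕ) × (ℕ × ℕ) | v.1.1 ≤ v.2.1 ∧ v.2.1 ≤ v.1.2.2 ∧
          v.1.1 < v.2.2 ∧ v.2.2 ≤ v.1.2.1 ∧ v.2.1 < v.1.2.1}.indicator (pieriTerm a y z) v := by
  have hcells : (YoungDiagram.ofRowLens [3, 2] (by decide)).cells
      = {(0, 0), (0, 1), (0, 2), (1, 0), (1, 1)} := by decide
  rw [← tsum_comp_eq_tsum_indicator
    (ι := SemistandardYoungTableau (YoungDiagram.ofRowLens [3, 2] (by decide)))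
    (e := fun T => ((T 0 0, T 1 1, T 0 2), (T 0 1, T 1 0)))]
  · refine tsum_congr fun T => ?_
    rw [hcells]
    simp [pieriTerm, hookTerm, pairTerm, zetaTerm, fillOfRows]
    ring
  · intro T T' h
    refine SemistandardYoungTableau.ext_of_mem ?_
    rw [hcells]
    simp_all
  · ext ⟨⟨p, r, q⟩, k, l⟩
    constructor
    · rintro ⟨T, hT⟩
      simp only [Prod.mk.injEq] at hT
      obtain ⟨⟨rfl, rfl, rfl⟩, rfl, rfl⟩ := hT
      exact ⟨T.row_weak (by decide) (by simp [mem_ofRowLens_iff_lt_getD]),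
        T.row_weak (by decide) (by simp [mem_ofRowLens_iff_lt_getD]),
        T.col_strict (by decide) (by simp [mem_ofRowLens_iff_lt_getD]),
        T.row_weak (by decide) (by simp [mem_ofRowLens_iff_lt_getD]),
        T.col_strict (by decide) (by simp [mem_ofRowLens_iff_lt_getD])⟩
    · rintro ⟨h₁, h₂, h₃, h₄, h₅⟩
      dsimp only at h₁ h₂ h₃ h₄ h₅
      obtain ⟨T, hT⟩ := SemistandardYoungTableau.exists_eq_on_cells
        (μ := YoungDiagram.ofRowLens [3, 2] (by decide))
        (fun i j => ([[p, k, q], [l, r]].getD i []).getD j 0)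
        (by
          rw [hcells]
          intro c hc j hj
          fin_cases hc <;> dsimp at hj ⊢
          all_goals interval_cases j
          all_goals simp
          all_goals omega)
        (by
          rw [hcells]
          intro c hc i hi
          fin_cases hc <;> dsimp at hi ⊢
          all_goals interval_cases i
          all_goals simp
          all_goals omega)
      rw [hcells] at hT
      refine ⟨T, ?_⟩
      simp_all

lemma MZV_pair_s7 :
    MZV [a, z] = ∑' v, {v : ℕ × ℕ | v.1 < v.2}.indicator (pairTerm a z) v := by
  rw [← tsum_comp_eq_tsum_indicator (ι := {f : Fin [a, z].length → ℕ+ // StrictMono f})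
    (e := fun f => ((f.1 (0 : Fin 2)).natPred, (f.1 (1 : Fin 2)).natPred))]
  · refine tsum_congr fun f => ?_
    refine (Fin.prod_univ_two _).trans ?_
    simp only [pairTerm, zetaTerm, PNat.natPred_add_one]
    rfl
  · rintro ⟨f, hf⟩ ⟨g, hg⟩ h
    simp only [Prod.mk.injEq, PNat.natPred_inj] at h
    refine Subtype.ext (funext fun i => ?_)
    change Fin 2 at i
    fin_cases i
    exacts [h.1, h.2]
  · ext ⟨k, l⟩
    constructor
    · rintro ⟨⟨f, hf⟩, h⟩
      simp only [Prod.mk.injEq] at h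
      obtain ⟨rfl, rfl⟩ := h
      exact PNat.natPred_lt_natPred.2 (hf (show (0 : Fin 2) < 1 by decide))
    · intro h
      refine ⟨⟨(![k.succPNat, l.succPNat] : Fin 2 → ℕ+), ?_⟩, ?_⟩
      · refine Fin.strictMono_iff_lt_succ (n := 1) |>.2 fun i => ?_
        fin_cases i
        exact Nat.succPNat_lt_succPNat.2 h
      · simp

end Expansions

/-- The permutation of the indices `((p, r, q), (k, l))` exchanging `p` and `k`. -/
def swapCornerPair : Equiv.Perm ((ℕ × ℕ × ℕ) × (ℕ × ℕ)) where
  toFun v := ((v.2.1, v.1.2.1, v.1.2.2), (v.1.1, v.2.2))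
  invFun v := ((v.2.1, v.1.2.1, v.1.2.2), (v.1.1, v.2.2))
  left_inv _ := rfl
  right_inv _ := rfl

/-- The permutation of the indices `((p, r, q), (k, l))` exchanging `r` and `k`. -/
def swapLegPair : Equiv.Perm ((ℕ × ℕ × ℕ) × (ℕ × ℕ)) where
  toFun v := ((v.1.1, v.2.1, v.1.2.2), (v.1.2.1, v.2.2))
  invFun v := ((v.1.1, v.2.1, v.1.2.2), (v.1.2.1, v.2.2))
  left_inv _ := rfl
  right_inv _ := rfl

lemma pieriTerm_swapCornerPair (a y z : ℂ) (v : (ℕ × ℕ × ℕ) × (ℕ × ℕ)) :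
    pieriTerm a y z (swapCornerPair v) = pieriTerm a y z v := by
  simp only [pieriTerm, hookTerm, pairTerm, swapCornerPair, Equiv.coe_fn_mk]
  ring

lemma pieriTerm_swapLegPair (a y z : ℂ) (v : (ℕ × ℕ × ℕ) × (ℕ × ℕ)) :
    pieriTerm a y z (swapLegPair v) = pieriTerm a y z v := by
  simp only [pieriTerm, hookTerm, pairTerm, swapLegPair, Equiv.coe_fn_mk]
  ring

lemma tsum_indicator_eq_of_comp_eq {X : Type*} (σ : Equiv.Perm X) {F : X → ℂ}
    (hF : ∀ x, F (σ x) = F x) (P : Set X) :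
    ∑' x, P.indicator F x = ∑' x, (σ ⁻¹' P).indicator F x := by
  rw [← σ.tsum_eq]
  refine tsum_congr fun x => ?_
  simp only [Set.indicator, hF]
  rfl

lemma tsum_indicator_add_add_add {X : Type*} {F : X → ℂ} (hF : Summable F) (A B C D : Set X) :
    ∑' x, A.indicator F x + ∑' x, B.indicator F x + ∑' x, C.indicator F x + ∑' x, D.indicator F x
      = ∑' x, (A.indicator F x + B.indicator F x + C.indicator F x + D.indicator F x) := by
  rw [((((hF.indicator A).add (hF.indicator B)).add (hF.indicator C))).tsum_add (hF.indicator D),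
    ((hF.indicator A).add (hF.indicator B)).tsum_add (hF.indicator C),
    (hF.indicator A).tsum_add (hF.indicator B)]

/-- the Pieri-type product `ζ_{(2,1)}(rows (a,y),(a)) · ζ(a,z)` expands with
no error terms. -/
theorem stmt7 (a y z : ℂ) (ha : 1 < a.re) (hy : 1 < y.re) (hz : 1 < z.re) :
    schurZeta (YoungDiagram.ofRowLens [2, 1] (by decide)) (fillOfRows [[a, y], [a]])
        * MZV [a, z]
    = schurZeta (YoungDiagram.ofRowLens [2, 1, 1, 1] (by decide))
          (fillOfRows [[a, y], [a], [a], [z]])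
      + schurZeta (YoungDiagram.ofRowLens [2, 2, 1] (by decide))
          (fillOfRows [[a, y], [a, a], [z]])
      + schurZeta (YoungDiagram.ofRowLens [3, 1, 1] (by decide))
          (fillOfRows [[a, a, y], [a], [z]])
      + schurZeta (YoungDiagram.ofRowLens [3, 2] (by decide))
          (fillOfRows [[a, a, y], [z, a]]) := by
  have hF := summable_pieriTerm ha hy hz
  have hcyc (v) : pieriTerm a y z ((swapLegPair.trans swapCornerPair) v) = pieriTerm a y z v := by
    rw [Equiv.trans_apply, pieriTerm_swapCornerPair, pieriTerm_swapLegPair]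
  rw [schurZeta_two_one, MZV_pair_s7, schurZeta_two_one_one_one, schurZeta_two_two_one,
    schurZeta_three_one_one, schurZeta_three_two, tsum_indicator_add_add_add hF,
    tsum_mul_tsum_of_summable_norm]
  · let A : Set ((ℕ × ℕ × ℕ) × (ℕ × ℕ)) := {v | v.1.1 ≤ v.1.2.2 ∧ v.1.1 < v.1.2.1 ∧
      v.2.1 < v.2.2 ∧ v.1.1 ≤ v.2.1 ∧ (v.2.1 ≤ v.1.2.2 ∨ v.1.2.1 ≤ v.2.1)}
    let B : Set ((ℕ × ℕ × ℕ) × (ℕ × ℕ)) := {v | v.1.1 ≤ v.1.2.2 ∧ v.1.1 < v.1.2.1 ∧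
      v.2.1 < v.2.2 ∧ v.2.1 < v.1.1 ∧ v.2.2 ≤ v.1.1}
    let C : Set ((ℕ × ℕ × ℕ) × (ℕ × ℕ)) := {v | v.1.1 ≤ v.1.2.2 ∧ v.1.1 < v.1.2.1 ∧
      v.2.1 < v.1.1 ∧ v.1.1 < v.2.2}
    let D : Set ((ℕ × ℕ × ℕ) × (ℕ × ℕ)) := {v | v.1.1 ≤ v.1.2.2 ∧ v.1.2.2 < v.2.1 ∧
      v.2.1 < v.1.2.1 ∧ v.2.1 < v.2.2}
    trans ∑' v, A.indicator (pieriTerm a y z) v + ∑' v, B.indicator (pieriTerm a y z) v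
      + ∑' v, C.indicator (pieriTerm a y z) v + ∑' v, D.indicator (pieriTerm a y z) v
    · rw [tsum_indicator_add_add_add hF]
      refine tsum_congr fun ⟨⟨p, r, q⟩, k, l⟩ => ?_
      simp only [A, B, C, D, Set.indicator, Set.mem_ofPred_eq, pieriTerm]
      split_ifs <;> first | (exfalso; omega) | simp
    · rw [tsum_indicator_eq_of_comp_eq swapCornerPair (pieriTerm_swapCornerPair a y z) B,
        tsum_indicator_eq_of_comp_eq _ hcyc C,
        tsum_indicator_eq_of_comp_eq swapLegPair (pieriTerm_swapLegPair a y z) D,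
        tsum_indicator_add_add_add hF]
      refine tsum_congr fun ⟨⟨p, r, q⟩, k, l⟩ => ?_
      simp only [A, B, C, D, Set.indicator, Set.mem_ofPred_eq, Set.mem_preimage, swapCornerPair,
        swapLegPair, Equiv.trans_apply, Equiv.coe_fn_mk]
      split_ifs <;> first | (exfalso; omega) | simp
  · exact (summable_norm_hookTerm ha hy).of_norm.indicator _ |>.norm
  · exact (summable_norm_pairTerm ha hz).of_norm.indicator _ |>.norm
end

section
/- Let x_1, x_2, y_1, z_1, z_2 be complex numbers with Re(x_1) ≥ 1, Re(z_1) ≥ 1, Re(y_1) > 1, Re(x_2) > 1 and Re(z_2) > 1. Then ζ_{(2,1)}(rows (x_1,y_1), (x_2)) · ζ(z_1, z_2) = ζ_{(2,1,1,1)}(rows (x_1,y_1), (x_2), (z_1), (z_2)) + ζ_{(2,2,1)}(rows (x_1,y_1), (z_1,x_2), (z_2)) + ζ_{(3,1,1)}(rows (z_1,x_1,y_1), (x_2), (z_2)) + ζ_{(3,2)}(rows (z_1,x_1,y_1), (z_2,x_2)) − Σ_{1≤p<q<r, q≤u≤v} p^{−z_1} q^{−x_2} u^{−x_1} v^{−y_1}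 r^{−z_2} + Σ_{1≤p<q<r, q≤u≤v} p^{−x_1} q^{−z_1} u^{−x_2} v^{−y_1} r^{−z_2}. -/
open scoped BigOperators

/-- The sum `Σ_{1 ≤ p < q < r, q ≤ u ≤ v} p^{-e_p} q^{-e_q} u^{-e_u} v^{-e_v} r^{-e_r}`,
indexed by tuples `(p, q, r, u, v)` of positive integers. -/
noncomputable def errSum (ep eq eu ev er : ℂ) : ℂ :=
  ∑' x : {x : ℕ+ × ℕ+ × ℕ+ × ℕ+ × ℕ+ //
      x.1 < x.2.1 ∧ x.2.1 < x.2.2.1 ∧ x.2.1 ≤ x.2.2.2.1 ∧ x.2.2.2.1 ≤ x.2.2.2.2},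
    (x.1.1 : ℂ) ^ (-ep) * (x.1.2.1 : ℂ) ^ (-eq) * (x.1.2.2.2.1 : ℂ) ^ (-eu) *
      (x.1.2.2.2.2 : ℂ) ^ (-ev) * (x.1.2.2.1 : ℂ) ^ (-er)

/-- A Schur multiple zeta function as a sum over any type `β` parametrizing the tableaux entries
by `e : β → ℕ → ℕ → ℕ`, restricted to the set `S` of semistandard parameters. -/
lemma schurZeta_eq_tsum_indicator {β : Type*} (μ : YoungDiagram) (s : ℕ → ℕ → ℂ)
    (e : β → ℕ → ℕ → ℕ) (S : Set β) (F : β → ℂ)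
    (hinj : ∀ x y, (∀ c ∈ μ.cells, e x c.1 c.2 = e y c.1 c.2) → x = y)
    (hsurj : ∀ T : ℕ → ℕ → ℕ, ∃ x, ∀ c ∈ μ.cells, e x c.1 c.2 = T c.1 c.2)
    (hS : ∀ x, x ∈ S ↔ ∀ c ∈ μ.cells, ∀ c' ∈ μ.cells,
      (c.1 = c'.1 → c.2 < c'.2 → e x c.1 c.2 ≤ e x c'.1 c'.2) ∧
      (c.2 = c'.2 → c.1 < c'.1 → e x c.1 c.2 < e x c'.1 c'.2))
    (hF : ∀ x, F x = ∏ c ∈ μ.cells, (((e x c.1 c.2 + 1 : ℕ) : ℂ)) ^ (-(s c.1 c.2))) :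
    schurZeta μ s = ∑' x, S.indicator F x := by
  choose g hg using fun T : SemistandardYoungTableau μ => hsurj T
  have hgi : Function.Injective g := by
    intro T T' h
    ext i j
    by_cases hc : (i, j) ∈ μ
    · rw [← hg T (i, j) hc, ← hg T' (i, j) hc, h]
    · rw [T.zeros hc, T'.zeros hc]
  have hgS : ∀ T, g T ∈ S := by
    intro T
    rw [hS]
    rintro ⟨i, j⟩ hc ⟨i', j'⟩ hc'
    rw [hg T _ hc, hg T _ hc']
    constructor
    · rintro rfl hj
      exact T.row_weak hj hc'
    · rintro rfl hi
      exact T.col_strict hi hc'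
  have hrange : Function.support (S.indicator F) ⊆ Set.range g := by
    intro x hx
    have hxS : x ∈ S := Set.mem_of_indicator_ne_zero hx
    rw [hS] at hxS
    let T : SemistandardYoungTableau μ :=
      { entry := fun i j => if (i, j) ∈ μ then e x i j else 0
        row_weak' := by
          intro i j1 j2 hj hc
          have hc1 : (i, j1) ∈ μ := μ.up_left_mem le_rfl hj.le hc
          simpa [hc, hc1] using (hxS _ hc1 _ hc).1 rfl hj
        col_strict' := by
          intro i1 i2 j hi hc
          have hc1 : (i1, j) ∈ μ := μ.up_left_mem hi.le le_rfl hc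
          simpa [hc, hc1] using (hxS _ hc1 _ hc).2 rfl hi
        zeros' := by
          intro i j hc
          simp [hc] }
    refine ⟨T, hinj _ _ fun c hc => ?_⟩
    rw [hg T c hc]
    exact if_pos hc
  rw [← hgi.tsum_eq hrange]
  refine tsum_congr fun T => ?_
  rw [Set.indicator_of_mem (hgS T), hF]
  exact Finset.prod_congr rfl fun c hc => by rw [hg T c hc]

lemma MZV_pair_eq_tsum_indicator (s t : ℂ) :
    MZV [s, t] = ∑' x : ℕ+ × ℕ+,
      {x : ℕ+ × ℕ+ | x.1 < x.2}.indicator (fun x => (x.1 : ℂ) ^ (-s) * (x.2 : ℂ) ^ (-t)) x := by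
  let g : {f : Fin [s, t].length → ℕ+ // StrictMono f} → ℕ+ × ℕ+ :=
    fun f => (f.1 (0 : Fin 2), f.1 (1 : Fin 2))
  have hgi : Function.Injective g := by
    rintro ⟨f, hf⟩ ⟨f', hf'⟩ h
    rw [Prod.mk.injEq] at h
    refine Subtype.ext (funext fun i => ?_)
    change Fin 2 at i
    fin_cases i
    exacts [h.1, h.2]
  have hgS : ∀ f, g f ∈ {x : ℕ+ × ℕ+ | x.1 < x.2} := fun f =>
    f.2 (show (0 : Fin 2) < 1 by decide)
  rw [← hgi.tsum_eq]
  · refine tsum_congr fun f => ?_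
    rw [Set.indicator_of_mem (hgS f)]
    exact Fin.prod_univ_two (fun i : Fin 2 => (f.1 i : ℂ) ^ (-([s, t].get i)))
  · rintro ⟨p, q⟩ hx
    have hpq : p < q := (Set.indicator_apply_ne_zero.1 hx).1
    refine ⟨⟨(![p, q] : Fin 2 → ℕ+), ?_⟩, rfl⟩
    exact (Fin.strictMono_iff_lt_succ (f := (![p, q] : Fin 2 → ℕ+))).2
      fun i => by fin_cases i; exact hpq

lemma errSum_eq_tsum_indicator {β : Type*} (ep eq eu ev er : ℂ)
    (e : β ≃ ℕ+ × ℕ+ × ℕ+ × ℕ+ × ℕ+) (S : Set β) (F : β → ℂ)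
    (hS : ∀ x, x ∈ S ↔ (e x).1 < (e x).2.1 ∧ (e x).2.1 < (e x).2.2.1 ∧
      (e x).2.1 ≤ (e x).2.2.2.1 ∧ (e x).2.2.2.1 ≤ (e x).2.2.2.2)
    (hF : ∀ x, F x = ((e x).1 : ℂ) ^ (-ep) * ((e x).2.1 : ℂ) ^ (-eq) *
      ((e x).2.2.2.1 : ℂ) ^ (-eu) * ((e x).2.2.2.2 : ℂ) ^ (-ev) * ((e x).2.2.1 : ℂ) ^ (-er)) :
    errSum ep eq eu ev er = ∑' x, S.indicator F x := by
  rw [← tsum_subtype S F, errSum, ← (e.subtypeEquiv hS).tsum_eq]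
  exact tsum_congr fun x => (hF x).symm

lemma summable_norm_indicator_le_cpow_mul_cpow {s t : ℂ} (hs : 1 ≤ s.re) (ht : 1 < t.re) :
    Summable fun x : ℕ+ × ℕ+ => ‖{x : ℕ+ × ℕ+ | x.1 ≤ x.2}.indicator
      (fun x => (x.1 : ℂ) ^ (-s) * (x.2 : ℂ) ^ (-t)) x‖ := by
  set ε : ℝ := (t.re - 1) / 2 with hε
  have hε0 : 0 < ε := by rw [hε]; linarith
  have h : Summable fun n : ℕ+ => ((n : ℕ) : ℝ) ^ (-(1 + ε)) :=
    (Real.summable_nat_rpow.2 (by linarith)).comp_injective PNat.coe_injective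
  refine (h.mul_of_nonneg h (fun n => by positivity) (fun n => by positivity)).of_nonneg_of_le
    (fun _ => norm_nonneg _) ?_
  rintro ⟨a, b⟩
  rw [norm_indicator_eq_indicator_norm]
  refine Set.indicator_apply_le' (fun hx => ?_) (fun _ => by positivity)
  have hab : (a : ℝ) ≤ (b : ℝ) := by exact_mod_cast (show a ≤ b from hx)
  have ha : (1 : ℝ) ≤ (a : ℝ) := by exact_mod_cast a.pos
  have ha0 : (0 : ℝ) < (a : ℝ) := by linarith
  have hb0 : (0 : ℝ) < (b : ℝ) := by linarith
  simp only [norm_mul]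
  rw [Complex.norm_natCast_cpow_of_pos a.pos, Complex.norm_natCast_cpow_of_pos b.pos,
    Complex.neg_re, Complex.neg_re]
  calc (a : ℝ) ^ (-s.re) * (b : ℝ) ^ (-t.re)
      ≤ (a : ℝ) ^ (-(1 : ℝ)) * (b : ℝ) ^ (-t.re) := by gcongr
    _ = (a : ℝ) ^ (-(1 + ε)) * (a : ℝ) ^ ε * (b : ℝ) ^ (-t.re) := by
        rw [← Real.rpow_add ha0]; ring_nf
    _ ≤ (a : ℝ) ^ (-(1 + ε)) * (b : ℝ) ^ ε * (b : ℝ) ^ (-t.re) := by gcongr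
    _ = (a : ℝ) ^ (-(1 + ε)) * (b : ℝ) ^ (-(1 + ε)) := by
        rw [mul_assoc, ← Real.rpow_add hb0, show ε + -t.re = -(1 + ε) by rw [hε]; ring]

/-- The condition `a ≤ b`, `d < e` on `(((a, b), c), (d, e))` bounds the terms of every series
occurring in the product formula. -/
lemma summable_indicator_cpow {x1 x2 y1 z1 z2 : ℂ} (hx1 : 1 ≤ x1.re) (hz1 : 1 ≤ z1.re)
    (hy1 : 1 < y1.re) (hx2 : 1 < x2.re) (hz2 : 1 < z2.re)
    (S : Set (((ℕ+ × ℕ+) × ℕ+) × (ℕ+ × ℕ+)))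
    (hS : ∀ x ∈ S, x.1.1.1 ≤ x.1.1.2 ∧ x.2.1 ≤ x.2.2) :
    Summable (S.indicator fun x : ((ℕ+ × ℕ+) × ℕ+) × (ℕ+ × ℕ+) =>
      (x.1.1.1 : ℂ) ^ (-x1) * (x.1.1.2 : ℂ) ^ (-y1) * (x.1.2 : ℂ) ^ (-x2) *
        ((x.2.1 : ℂ) ^ (-z1) * (x.2.2 : ℂ) ^ (-z2))) := by
  have h1 := summable_norm_indicator_le_cpow_mul_cpow hx1 hy1
  have h2 := summable_norm_indicator_le_cpow_mul_cpow hz1 hz2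
  have h3 := (h1.mul_norm (summable_norm_pnat_cpow hx2)).mul_norm h2
  refine Summable.of_norm_bounded h3 ?_
  intro x
  rw [norm_indicator_eq_indicator_norm]
  refine Set.indicator_apply_le' (fun hx => ?_) (fun _ => norm_nonneg _)
  rw [Set.indicator_of_mem (s := {x : ℕ+ × ℕ+ | x.1 ≤ x.2}) (hS x hx).1,
    Set.indicator_of_mem (s := {x : ℕ+ × ℕ+ | x.1 ≤ x.2}) (hS x hx).2]

lemma natCast_natPred_add_one (n : ℕ+) : (n.natPred : ℂ) + 1 = (n : ℂ) := by
  exact_mod_cast congrArg (Nat.cast (R := ℂ)) n.natPred_add_one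

lemma schurZeta_two_one_s8 (x1 x2 y1 : ℂ) :
    schurZeta (YoungDiagram.ofRowLens [2, 1] (by decide)) (fillOfRows [[x1, y1], [x2]]) =
      ∑' x : (ℕ+ × ℕ+) × ℕ+, {x : (ℕ+ × ℕ+) × ℕ+ |
        x.1.1 ≤ x.1.2 ∧ x.1.1 < x.2}.indicator
        (fun x => (x.1.1 : ℂ) ^ (-x1) * (x.1.2 : ℂ) ^ (-y1) * (x.2 : ℂ) ^ (-x2)) x := by
  have hc : (YoungDiagram.ofRowLens [2, 1] (by decide)).cells =
      {(0, 0), (0, 1), (1, 0)} := by decide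
  apply schurZeta_eq_tsum_indicator _ _ (fun x i j =>
    (([[x.1.1.natPred, x.1.2.natPred], [x.2.natPred]] :
      List (List ℕ)).getD i []).getD j 0)
  · rintro ⟨⟨a, b⟩, c⟩ ⟨⟨a', b'⟩, c'⟩
    simp +contextual [hc]
  · intro T
    refine ⟨(((T 0 0).succPNat, (T 0 1).succPNat), (T 1 0).succPNat), ?_⟩
    simp [hc]
  · rintro ⟨⟨a, b⟩, c⟩
    simp only [hc, Finset.forall_mem_insert, Finset.mem_singleton, forall_eq, Set.mem_ofPred_eq]
    simp
  · rintro ⟨⟨a, b⟩, c⟩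
    simp [hc, fillOfRows, natCast_natPred_add_one, -mul_eq_mul_left_iff, -mul_eq_mul_right_iff]
    ring

lemma schurZeta_two_one_one_one_s8 (x1 x2 y1 z1 z2 : ℂ) :
    schurZeta (YoungDiagram.ofRowLens [2, 1, 1, 1] (by decide)) (fillOfRows [[x1, y1], [x2], [z1], [z2]]) =
      ∑' x : ((ℕ+ × ℕ+) × ℕ+) × (ℕ+ × ℕ+), {x : ((ℕ+ × ℕ+) × ℕ+) × (ℕ+ × ℕ+) |
        x.1.1.1 ≤ x.1.1.2 ∧ x.1.1.1 < x.1.2 ∧ x.1.2 < x.2.1 ∧ x.2.1 < x.2.2}.indicator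
        (fun x => (x.1.1.1 : ℂ) ^ (-x1) * (x.1.1.2 : ℂ) ^ (-y1) * (x.1.2 : ℂ) ^ (-x2) *
          ((x.2.1 : ℂ) ^ (-z1) * (x.2.2 : ℂ) ^ (-z2))) x := by
  have hc : (YoungDiagram.ofRowLens [2, 1, 1, 1] (by decide)).cells =
      {(0, 0), (0, 1), (1, 0), (2, 0), (3, 0)} := by decide
  apply schurZeta_eq_tsum_indicator _ _ (fun x i j =>
    (([[x.1.1.1.natPred, x.1.1.2.natPred], [x.1.2.natPred], [x.2.1.natPred], [x.2.2.natPred]] :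
      List (List ℕ)).getD i []).getD j 0)
  · rintro ⟨⟨⟨a, b⟩, c⟩, ⟨d, e⟩⟩ ⟨⟨⟨a', b'⟩, c'⟩, ⟨d', e'⟩⟩
    simp +contextual [hc]
  · intro T
    refine ⟨((((T 0 0).succPNat, (T 0 1).succPNat), (T 1 0).succPNat), ((T 2 0).succPNat, (T 3 0).succPNat)), ?_⟩
    simp [hc]
  · rintro ⟨⟨⟨a, b⟩, c⟩, ⟨d, e⟩⟩
    simp only [hc, Finset.forall_mem_insert, Finset.mem_singleton, forall_eq, Set.mem_ofPred_eq]
    simp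
    grind
  · rintro ⟨⟨⟨a, b⟩, c⟩, ⟨d, e⟩⟩
    simp [hc, fillOfRows, natCast_natPred_add_one, -mul_eq_mul_left_iff, -mul_eq_mul_right_iff]
    ring

lemma schurZeta_two_two_one_s8 (x1 x2 y1 z1 z2 : ℂ) :
    schurZeta (YoungDiagram.ofRowLens [2, 2, 1] (by decide)) (fillOfRows [[x1, y1], [z1, x2], [z2]]) =
      ∑' x : ((ℕ+ × ℕ+) × ℕ+) × (ℕ+ × ℕ+), {x : ((ℕ+ × ℕ+) × ℕ+) × (ℕ+ × ℕ+) |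
        x.1.1.1 ≤ x.1.1.2 ∧ x.1.1.1 < x.2.1 ∧ x.2.1 ≤ x.1.2 ∧ x.1.1.2 < x.1.2 ∧ x.2.1 < x.2.2}.indicator
        (fun x => (x.1.1.1 : ℂ) ^ (-x1) * (x.1.1.2 : ℂ) ^ (-y1) * (x.1.2 : ℂ) ^ (-x2) *
          ((x.2.1 : ℂ) ^ (-z1) * (x.2.2 : ℂ) ^ (-z2))) x := by
  have hc : (YoungDiagram.ofRowLens [2, 2, 1] (by decide)).cells =
      {(0, 0), (0, 1), (1, 0), (1, 1), (2, 0)} := by decide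
  apply schurZeta_eq_tsum_indicator _ _ (fun x i j =>
    (([[x.1.1.1.natPred, x.1.1.2.natPred], [x.2.1.natPred, x.1.2.natPred], [x.2.2.natPred]] :
      List (List ℕ)).getD i []).getD j 0)
  · rintro ⟨⟨⟨a, b⟩, c⟩, ⟨d, e⟩⟩ ⟨⟨⟨a', b'⟩, c'⟩, ⟨d', e'⟩⟩
    simp +contextual [hc]
  · intro T
    refine ⟨((((T 0 0).succPNat, (T 0 1).succPNat), (T 1 1).succPNat), ((T 1 0).succPNat, (T 2 0).succPNat)), ?_⟩
    simp [hc]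
  · rintro ⟨⟨⟨a, b⟩, c⟩, ⟨d, e⟩⟩
    simp only [hc, Finset.forall_mem_insert, Finset.mem_singleton, forall_eq, Set.mem_ofPred_eq]
    simp
    grind
  · rintro ⟨⟨⟨a, b⟩, c⟩, ⟨d, e⟩⟩
    simp [hc, fillOfRows, natCast_natPred_add_one, -mul_eq_mul_left_iff, -mul_eq_mul_right_iff]
    ring

lemma schurZeta_three_one_one_s8 (x1 x2 y1 z1 z2 : ℂ) :
    schurZeta (YoungDiagram.ofRowLens [3, 1, 1] (by decide)) (fillOfRows [[z1, x1, y1], [x2], [z2]]) =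
      ∑' x : ((ℕ+ × ℕ+) × ℕ+) × (ℕ+ × ℕ+), {x : ((ℕ+ × ℕ+) × ℕ+) × (ℕ+ × ℕ+) |
        x.2.1 ≤ x.1.1.1 ∧ x.1.1.1 ≤ x.1.1.2 ∧ x.2.1 < x.1.2 ∧ x.1.2 < x.2.2}.indicator
        (fun x => (x.1.1.1 : ℂ) ^ (-x1) * (x.1.1.2 : ℂ) ^ (-y1) * (x.1.2 : ℂ) ^ (-x2) *
          ((x.2.1 : ℂ) ^ (-z1) * (x.2.2 : ℂ) ^ (-z2))) x := by
  have hc : (YoungDiagram.ofRowLens [3, 1, 1] (by decide)).cells =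
      {(0, 0), (0, 1), (0, 2), (1, 0), (2, 0)} := by decide
  apply schurZeta_eq_tsum_indicator _ _ (fun x i j =>
    (([[x.2.1.natPred, x.1.1.1.natPred, x.1.1.2.natPred], [x.1.2.natPred], [x.2.2.natPred]] :
      List (List ℕ)).getD i []).getD j 0)
  · rintro ⟨⟨⟨a, b⟩, c⟩, ⟨d, e⟩⟩ ⟨⟨⟨a', b'⟩, c'⟩, ⟨d', e'⟩⟩
    simp +contextual [hc]
  · intro T
    refine ⟨((((T 0 1).succPNat, (T 0 2).succPNat), (T 1 0).succPNat), ((T 0 0).succPNat, (T 2 0).succPNat)), ?_⟩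
    simp [hc]
  · rintro ⟨⟨⟨a, b⟩, c⟩, ⟨d, e⟩⟩
    simp only [hc, Finset.forall_mem_insert, Finset.mem_singleton, forall_eq, Set.mem_ofPred_eq]
    simp
    grind
  · rintro ⟨⟨⟨a, b⟩, c⟩, ⟨d, e⟩⟩
    simp [hc, fillOfRows, natCast_natPred_add_one, -mul_eq_mul_left_iff, -mul_eq_mul_right_iff]
    ring

lemma schurZeta_three_two_s8 (x1 x2 y1 z1 z2 : ℂ) :
    schurZeta (YoungDiagram.ofRowLens [3, 2] (by decide)) (fillOfRows [[z1, x1, y1], [z2, x2]]) =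
      ∑' x : ((ℕ+ × ℕ+) × ℕ+) × (ℕ+ × ℕ+), {x : ((ℕ+ × ℕ+) × ℕ+) × (ℕ+ × ℕ+) |
        x.2.1 ≤ x.1.1.1 ∧ x.1.1.1 ≤ x.1.1.2 ∧ x.2.1 < x.2.2 ∧ x.2.2 ≤ x.1.2 ∧ x.1.1.1 < x.1.2}.indicator
        (fun x => (x.1.1.1 : ℂ) ^ (-x1) * (x.1.1.2 : ℂ) ^ (-y1) * (x.1.2 : ℂ) ^ (-x2) *
          ((x.2.1 : ℂ) ^ (-z1) * (x.2.2 : ℂ) ^ (-z2))) x := by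
  have hc : (YoungDiagram.ofRowLens [3, 2] (by decide)).cells =
      {(0, 0), (0, 1), (0, 2), (1, 0), (1, 1)} := by decide
  apply schurZeta_eq_tsum_indicator _ _ (fun x i j =>
    (([[x.2.1.natPred, x.1.1.1.natPred, x.1.1.2.natPred], [x.2.2.natPred, x.1.2.natPred]] :
      List (List ℕ)).getD i []).getD j 0)
  · rintro ⟨⟨⟨a, b⟩, c⟩, ⟨d, e⟩⟩ ⟨⟨⟨a', b'⟩, c'⟩, ⟨d', e'⟩⟩
    simp +contextual [hc]
  · intro T
    refine ⟨((((T 0 1).succPNat, (T 0 2).succPNat), (T 1 1).succPNat), ((T 0 0).succPNat, (T 1 0).succPNat)), ?_⟩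
    simp [hc]
  · rintro ⟨⟨⟨a, b⟩, c⟩, ⟨d, e⟩⟩
    simp only [hc, Finset.forall_mem_insert, Finset.mem_singleton, forall_eq, Set.mem_ofPred_eq]
    simp
    grind
  · rintro ⟨⟨⟨a, b⟩, c⟩, ⟨d, e⟩⟩
    simp [hc, fillOfRows, natCast_natPred_add_one, -mul_eq_mul_left_iff, -mul_eq_mul_right_iff]
    ring

lemma errSum_z1_x2_x1_y1_z2 (x1 x2 y1 z1 z2 : ℂ) :
    errSum z1 x2 x1 y1 z2 = ∑' x : ((ℕ+ × ℕ+) × ℕ+) × (ℕ+ × ℕ+), {x : ((ℕ+ × ℕ+) × ℕ+) × (ℕ+ × ℕ+) |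
        x.2.1 < x.1.2 ∧ x.1.2 < x.2.2 ∧ x.1.2 ≤ x.1.1.1 ∧ x.1.1.1 ≤ x.1.1.2}.indicator
        (fun x => (x.1.1.1 : ℂ) ^ (-x1) * (x.1.1.2 : ℂ) ^ (-y1) * (x.1.2 : ℂ) ^ (-x2) *
          ((x.2.1 : ℂ) ^ (-z1) * (x.2.2 : ℂ) ^ (-z2))) x := by
  apply errSum_eq_tsum_indicator _ _ _ _ _
    { toFun := fun x => (x.2.1, x.1.2, x.2.2, x.1.1.1, x.1.1.2)
      invFun := fun y => (((y.2.2.2.1, y.2.2.2.2), y.2.1), (y.1, y.2.2.1))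
      left_inv := fun _ => rfl
      right_inv := fun _ => rfl }
  · exact fun _ => Iff.rfl
  · rintro ⟨⟨⟨a, b⟩, c⟩, ⟨d, e⟩⟩
    simp only [Equiv.coe_fn_mk]
    ring

lemma errSum_x1_z1_x2_y1_z2 (x1 x2 y1 z1 z2 : ℂ) :
    errSum x1 z1 x2 y1 z2 = ∑' x : ((ℕ+ × ℕ+) × ℕ+) × (ℕ+ × ℕ+), {x : ((ℕ+ × ℕ+) × ℕ+) × (ℕ+ × ℕ+) |
        x.1.1.1 < x.2.1 ∧ x.2.1 < x.2.2 ∧ x.2.1 ≤ x.1.2 ∧ x.1.2 ≤ x.1.1.2}.indicator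
        (fun x => (x.1.1.1 : ℂ) ^ (-x1) * (x.1.1.2 : ℂ) ^ (-y1) * (x.1.2 : ℂ) ^ (-x2) *
          ((x.2.1 : ℂ) ^ (-z1) * (x.2.2 : ℂ) ^ (-z2))) x := by
  apply errSum_eq_tsum_indicator _ _ _ _ _
    { toFun := fun x => (x.1.1.1, x.2.1, x.2.2, x.1.2, x.1.1.2)
      invFun := fun y => (((y.1, y.2.2.2.2), y.2.2.2.1), (y.2.1, y.2.2.1))
      left_inv := fun _ => rfl
      right_inv := fun _ => rfl }
  · exact fun _ => Iff.rfl
  · rintro ⟨⟨⟨a, b⟩, c⟩, ⟨d, e⟩⟩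
    simp only [Equiv.coe_fn_mk]
    ring

lemma schurZeta_two_one_mul_MZV_pair {x1 x2 y1 z1 z2 : ℂ} (hx1 : 1 ≤ x1.re) (hz1 : 1 ≤ z1.re)
    (hy1 : 1 < y1.re) (hx2 : 1 < x2.re) (hz2 : 1 < z2.re) :
    schurZeta (YoungDiagram.ofRowLens [2, 1] (by decide)) (fillOfRows [[x1, y1], [x2]])
        * MZV [z1, z2] =
      ∑' x : ((ℕ+ × ℕ+) × ℕ+) × (ℕ+ × ℕ+), {x : ((ℕ+ × ℕ+) × ℕ+) × (ℕ+ × ℕ+) |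
        x.1.1.1 ≤ x.1.1.2 ∧ x.1.1.1 < x.1.2 ∧ x.2.1 < x.2.2}.indicator
        (fun x => (x.1.1.1 : ℂ) ^ (-x1) * (x.1.1.2 : ℂ) ^ (-y1) * (x.1.2 : ℂ) ^ (-x2) *
          ((x.2.1 : ℂ) ^ (-z1) * (x.2.2 : ℂ) ^ (-z2))) x := by
  rw [schurZeta_two_one_s8, MZV_pair_eq_tsum_indicator, tsum_mul_tsum_of_summable_norm]
  · refine tsum_congr fun x => ?_
    simp only [Set.indicator_apply, Set.mem_ofPred_eq, ite_mul, mul_ite, zero_mul, mul_zero]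
    split_ifs <;> first | rfl | grind
  · refine ((summable_norm_indicator_le_cpow_mul_cpow hx1 hy1).mul_norm
      (summable_norm_pnat_cpow hx2)).of_nonneg_of_le (fun _ => norm_nonneg _) fun x => ?_
    rw [norm_indicator_eq_indicator_norm]
    refine Set.indicator_apply_le' (fun hx => ?_) (fun _ => norm_nonneg _)
    rw [Set.indicator_of_mem (s := {x : ℕ+ × ℕ+ | x.1 ≤ x.2}) hx.1]
  · refine (summable_norm_indicator_le_cpow_mul_cpow hz1 hz2).of_nonneg_of_le
      (fun _ => norm_nonneg _) fun x => ?_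
    simp only [norm_indicator_eq_indicator_norm]
    refine Set.indicator_apply_le' (fun hx => ?_)
      (fun _ => Set.indicator_nonneg (fun _ _ => norm_nonneg _) _)
    rw [Set.indicator_of_mem (s := {x : ℕ+ × ℕ+ | x.1 ≤ x.2}) (show x.1 ≤ x.2 from le_of_lt hx)]

/-- The pairs `a ≤ b`, `a < c`, `d < e` are split according to the position of `d` relative to
`a`, `b`, `c`. -/
lemma ite_pieri_decomposition {α M : Type*} [LinearOrder α] [AddCommGroup M] (a b c d e : α)
    (w : M) :
    (if a ≤ b ∧ a < c ∧ d < e then w else 0) =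
      (if a ≤ b ∧ a < c ∧ c < d ∧ d < e then w else 0) +
      (if a ≤ b ∧ a < d ∧ d ≤ c ∧ b < c ∧ d < e then w else 0) +
      (if d ≤ a ∧ a ≤ b ∧ d < c ∧ c < e then w else 0) +
      (if d ≤ a ∧ a ≤ b ∧ d < e ∧ e ≤ c ∧ a < c then w else 0) -
      (if d < c ∧ c < e ∧ c ≤ a ∧ a ≤ b then w else 0) +
      (if a < d ∧ d < e ∧ d ≤ c ∧ c ≤ b then w else 0) := by
  rcases le_or_gt d a with hda | hda
  · have h1 : ¬(a ≤ b ∧ a < c ∧ c < d ∧ d < e) := by grind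
    have h2 : ¬(a ≤ b ∧ a < d ∧ d ≤ c ∧ b < c ∧ d < e) := by grind
    have h3 : ¬(a < d ∧ d < e ∧ d ≤ c ∧ c ≤ b) := by grind
    rw [if_neg h1, if_neg h2, if_neg h3]
    rcases le_or_gt c a with hca | hca <;> rcases le_or_gt e c with hec | hec <;> grind
  · have h1 : ¬(d ≤ a ∧ a ≤ b ∧ d < c ∧ c < e) := by grind
    have h2 : ¬(d ≤ a ∧ a ≤ b ∧ d < e ∧ e ≤ c ∧ a < c) := by grind
    have h3 : ¬(d < c ∧ c < e ∧ c ≤ a ∧ a ≤ b) := by grind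
    rw [if_neg h1, if_neg h2, if_neg h3]
    rcases le_or_gt d c with hdc | hdc <;> rcases le_or_gt c b with hcb | hcb <;> grind

lemma tsum_eq_of_pointwise_add_sub {β : Type*} {f f1 f2 f3 f4 f5 f6 : β → ℂ}
    (h : ∀ x, f x = f1 x + f2 x + f3 x + f4 x - f5 x + f6 x)
    (h1 : Summable f1) (h2 : Summable f2) (h3 : Summable f3) (h4 : Summable f4)
    (h5 : Summable f5) (h6 : Summable f6) :
    ∑' x, f x = ∑' x, f1 x + ∑' x, f2 x + ∑' x, f3 x + ∑' x, f4 x - ∑' x, f5 x + ∑' x, f6 x := by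
  rw [tsum_congr h]
  exact (((((h1.hasSum.add h2.hasSum).add h3.hasSum).add h4.hasSum).sub h5.hasSum).add
    h6.hasSum).tsum_eq

/-- the Pieri-type product `ζ_{(2,1)}(rows (x₁,y₁),(x₂)) · ζ(z₁,z₂)`
with its two explicit error terms. -/
theorem stmt8 (x1 x2 y1 z1 z2 : ℂ) (hx1 : 1 ≤ x1.re) (hz1 : 1 ≤ z1.re)
    (hy1 : 1 < y1.re) (hx2 : 1 < x2.re) (hz2 : 1 < z2.re) :
    schurZeta (YoungDiagram.ofRowLens [2, 1] (by decide)) (fillOfRows [[x1, y1], [x2]])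
        * MZV [z1, z2]
    = schurZeta (YoungDiagram.ofRowLens [2, 1, 1, 1] (by decide))
          (fillOfRows [[x1, y1], [x2], [z1], [z2]])
      + schurZeta (YoungDiagram.ofRowLens [2, 2, 1] (by decide))
          (fillOfRows [[x1, y1], [z1, x2], [z2]])
      + schurZeta (YoungDiagram.ofRowLens [3, 1, 1] (by decide))
          (fillOfRows [[z1, x1, y1], [x2], [z2]])
      + schurZeta (YoungDiagram.ofRowLens [3, 2] (by decide))
          (fillOfRows [[z1, x1, y1], [z2, x2]])
      - errSum z1 x2 x1 y1 z2
      + errSum x1 z1 x2 y1 z2 := by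
  have hs := summable_indicator_cpow hx1 hz1 hy1 hx2 hz2
  rw [schurZeta_two_one_mul_MZV_pair hx1 hz1 hy1 hx2 hz2, schurZeta_two_one_one_one_s8,
    schurZeta_two_two_one_s8, schurZeta_three_one_one_s8, schurZeta_three_two_s8, errSum_z1_x2_x1_y1_z2,
    errSum_x1_z1_x2_y1_z2]
  refine tsum_eq_of_pointwise_add_sub ?_ (hs _ ?_) (hs _ ?_) (hs _ ?_) (hs _ ?_) (hs _ ?_) (hs _ ?_)
  · rintro ⟨⟨⟨a, b⟩, c⟩, ⟨d, e⟩⟩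
    simp only [Set.indicator_apply, Set.mem_ofPred_eq]
    exact ite_pieri_decomposition a b c d e _
  all_goals
    clear hs
    rintro ⟨⟨⟨a, b⟩, c⟩, ⟨d, e⟩⟩ hx
    simp only [Set.mem_ofPred_eq] at hx ⊢
    grind
end

section
/- Let λ be a partition, let m ≥ 1 be an integer, and let s be a complex number with Re(s) > 1. For any partition μ, let {s}^μ denote the constant filling of the Young diagram of μ in which every box carries the value s. Then ζ_λ({s}^λ) · ζ⋆(s,…,s) (with m copies of s) = Σ_μ ζ_μ({s}^μ), where the sum runs over all partitions μ containing λ with |μ| = |λ| + m such that μ/λ is a horizontal strip, i.e. no two boxes of μ∖λ lie in the same column; equivalently μ_1 ≥ λ_1 ≥ μ_2 ≥ λ_2 ≥ μ_3 ≥ ⋯. -/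
open scoped BigOperators

namespace YoungDiagram

/-- The Young diagram whose row lengths are given by an antitone, eventually vanishing function
(and the empty diagram if the function does not have these properties). -/
noncomputable def ofRowFun (f : ℕ → ℕ) : YoungDiagram :=
  open scoped Classical in
  if h : Antitone f ∧ ∃ n, f n = 0 then
    { cells := (Finset.range h.2.choose ×ˢ Finset.range (f 0)).filter fun c => c.2 < f c.1
      isLowerSet := by
        rintro ⟨i, j⟩ ⟨i', j'⟩ hle hc
        obtain ⟨hi, hj⟩ := Prod.mk_le_mk.1 hle
        have := h.1 hi
        simp only [Finset.coe_filter, Finset.mem_product, Finset.mem_range, Set.mem_ofPred_eq]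
          at hc ⊢
        omega }
  else ⊥

theorem mem_ofRowFun {f : ℕ → ℕ} (hf : Antitone f) {n : ℕ} (hn : f n = 0) {i j : ℕ} :
    (i, j) ∈ ofRowFun f ↔ j < f i := by
  have h : Antitone f ∧ ∃ n, f n = 0 := ⟨hf, n, hn⟩
  rw [ofRowFun, dif_pos h]
  change (i, j) ∈ Finset.filter _ _ ↔ _
  rw [Finset.mem_filter, Finset.mem_product, Finset.mem_range, Finset.mem_range]
  refine ⟨fun hc => hc.2, fun hc => ⟨⟨?_, hc.trans_le (hf (Nat.zero_le i))⟩, hc⟩⟩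
  by_contra! hi
  exact (Nat.not_lt_zero j) (hc.trans_le ((hf hi).trans_eq h.2.choose_spec))

theorem rowLen_ofRowFun {f : ℕ → ℕ} (hf : Antitone f) {n : ℕ} (hn : f n = 0) (i : ℕ) :
    (ofRowFun f).rowLen i = f i :=
  eq_of_forall_lt_iff fun j => by rw [← mem_iff_lt_rowLen, mem_ofRowFun hf hn]

theorem ext_rowLen {μ ν : YoungDiagram} (h : ∀ i, μ.rowLen i = ν.rowLen i) : μ = ν := by
  refine SetLike.ext fun ⟨i, j⟩ => ?_
  rw [mem_iff_lt_rowLen, mem_iff_lt_rowLen, h]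

theorem le_iff_rowLen_le {μ ν : YoungDiagram} : μ ≤ ν ↔ ∀ i, μ.rowLen i ≤ ν.rowLen i := by
  refine ⟨fun h i => le_of_forall_lt fun j hj => ?_, fun h => ?_⟩
  · exact mem_iff_lt_rowLen.1 (h (mem_iff_lt_rowLen.2 hj))
  · rintro ⟨i, j⟩ hc
    exact mem_iff_lt_rowLen.2 ((mem_iff_lt_rowLen.1 hc).trans_le (h i))

theorem rowLen_colLen_zero (μ : YoungDiagram) : μ.rowLen (μ.colLen 0) = 0 := by
  by_contra h
  exact lt_irrefl _ (mem_iff_lt_colLen.1 (mem_iff_lt_rowLen.2 (Nat.pos_of_ne_zero h)))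

theorem exists_rowLen_eq_zero (μ ν κ : YoungDiagram) :
    ∃ n, μ.rowLen n = 0 ∧ ν.rowLen n = 0 ∧ κ.rowLen n = 0 := by
  have key (ρ : YoungDiagram) {n : ℕ} (hn : ρ.colLen 0 ≤ n) : ρ.rowLen n = 0 :=
    Nat.eq_zero_of_le_zero ((ρ.rowLen_anti _ _ hn).trans_eq ρ.rowLen_colLen_zero)
  exact ⟨μ.colLen 0 + ν.colLen 0 + κ.colLen 0, key _ (by omega), key _ (by omega),
    key _ (by omega)⟩

theorem card_cells_eq_sum_rowLen (μ : YoungDiagram) {n : ℕ} (hn : μ.rowLen n = 0) :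
    μ.cells.card = ∑ i ∈ Finset.range n, μ.rowLen i := by
  rw [Finset.card_eq_sum_card_fiberwise (f := Prod.fst) (t := Finset.range n)]
  · refine Finset.sum_congr rfl fun i _ => ?_
    rw [rowLen_eq_card, row]
  · rintro ⟨i, j⟩ hc
    simp only [Finset.coe_range, Set.mem_Iio]
    by_contra! hi
    have h1 := μ.rowLen_anti _ _ hi
    have h2 : j < μ.rowLen i := mem_iff_lt_rowLen.1 hc
    omega

theorem eq_bot_iff_card_eq_zero {μ : YoungDiagram} : μ = ⊥ ↔ μ.cells.card = 0 := by
  rw [Finset.card_eq_zero, YoungDiagram.ext_iff, cells_bot]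

theorem cells_subset_of_card_le {μ : YoungDiagram} {n : ℕ} (h : μ.cells.card ≤ n) :
    μ.cells ⊆ Finset.range n ×ˢ Finset.range n := by
  rintro ⟨i, j⟩ hc
  have hi : i < μ.colLen j := mem_iff_lt_colLen.1 hc
  have hj : j < μ.rowLen i := mem_iff_lt_rowLen.1 hc
  rw [colLen_eq_card] at hi
  rw [rowLen_eq_card] at hj
  have h1 : (μ.col j).card ≤ μ.cells.card := Finset.card_le_card (Finset.filter_subset _ _)
  have h2 : (μ.row i).card ≤ μ.cells.card := Finset.card_le_card (Finset.filter_subset _ _)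
  simp only [Finset.mem_product, Finset.mem_range]
  omega

theorem finite_setOf_card_le (n : ℕ) : {μ : YoungDiagram | μ.cells.card ≤ n}.Finite := by
  refine ((Finset.finite_toSet (Finset.range n ×ˢ Finset.range n).powerset).preimage
    (f := YoungDiagram.cells) fun μ _ ν _ h => YoungDiagram.ext h).subset fun μ hμ => ?_
  exact Finset.mem_coe.2 (Finset.mem_powerset.2 (cells_subset_of_card_le hμ))

/-- `μ / ν` is a horizontal strip, expressed through interlacing row lengths. -/
def IsHorizontalStrip (ν μ : YoungDiagram) : Prop :=
  ∀ i, ν.rowLen i ≤ μ.rowLen i ∧ μ.rowLen (i + 1) ≤ ν.rowLen i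

theorem IsHorizontalStrip.le {ν μ : YoungDiagram} (h : IsHorizontalStrip ν μ) : ν ≤ μ :=
  le_iff_rowLen_le.2 fun i => (h i).1

theorem IsHorizontalStrip.card_le {ν μ : YoungDiagram} (h : IsHorizontalStrip ν μ) :
    ν.cells.card ≤ μ.cells.card :=
  Finset.card_le_card (cells_subset_iff.2 h.le)

theorem isHorizontalStrip_iff {ν μ : YoungDiagram} :
    IsHorizontalStrip ν μ ↔ ν ≤ μ ∧ ∀ i₁ i₂ j : ℕ, (i₁, j) ∈ μ.cells → (i₁, j) ∉ ν.cells →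
      (i₂, j) ∈ μ.cells → (i₂, j) ∉ ν.cells → i₁ = i₂ := by
  simp only [mem_cells, mem_iff_lt_rowLen, not_lt]
  refine ⟨fun h => ⟨h.le, fun i₁ i₂ j h1 h2 h3 h4 => ?_⟩, fun ⟨hle, h⟩ i => ?_⟩
  · rcases lt_trichotomy i₁ i₂ with hi | hi | hi
    · have := μ.rowLen_anti _ _ (Nat.succ_le_of_lt hi)
      have := (h i₁).2
      simp only [Nat.succ_eq_add_one] at *
      omega
    · exact hi
    · have := μ.rowLen_anti _ _ (Nat.succ_le_of_lt hi)
      have := (h i₂).2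
      simp only [Nat.succ_eq_add_one] at *
      omega
  · refine ⟨le_iff_rowLen_le.1 hle i, ?_⟩
    by_contra! hlt
    have h1 := μ.rowLen_anti _ _ (Nat.le_succ i)
    have h2 := ν.rowLen_anti _ _ (Nat.le_succ i)
    have := h i (i + 1) (ν.rowLen i) (hlt.trans_le h1) le_rfl hlt h2
    omega

open scoped Classical in
/-- The diagrams obtained from `μ` by removing a horizontal strip. -/
noncomputable def stripRemovals (μ : YoungDiagram) : Finset YoungDiagram :=
  (finite_setOf_card_le μ.cells.card).toFinset.filter fun ν => IsHorizontalStrip ν μ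

open scoped Classical in
/-- The diagrams obtained from `ν` by adding a horizontal strip of size `m`. -/
noncomputable def stripAdditions (ν : YoungDiagram) (m : ℕ) : Finset YoungDiagram :=
  (finite_setOf_card_le (ν.cells.card + m)).toFinset.filter fun μ =>
    IsHorizontalStrip ν μ ∧ μ.cells.card = ν.cells.card + m

@[simp]
theorem mem_stripRemovals {ν μ : YoungDiagram} : ν ∈ stripRemovals μ ↔ IsHorizontalStrip ν μ := by
  simpa [stripRemovals] using fun h : IsHorizontalStrip ν μ => h.card_le

@[simp]
theorem mem_stripAdditions {ν μ : YoungDiagram} {m : ℕ} : μ ∈ stripAdditions ν m ↔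
    IsHorizontalStrip ν μ ∧ μ.cells.card = ν.cells.card + m := by
  simpa [stripAdditions] using fun (_ : IsHorizontalStrip ν μ) h => le_of_eq h

/-- The row lengths of the diagram above `μ` and `ν` in the local growth rule. -/
def growthFun (μ ν κ : YoungDiagram) (k : ℕ) : ℕ → ℕ
  | 0 => max (μ.rowLen 0) (ν.rowLen 0) + k
  | i + 1 => max (μ.rowLen (i + 1)) (ν.rowLen (i + 1)) + min (μ.rowLen i) (ν.rowLen i)
      - κ.rowLen i

/-- The row lengths of the diagram below `μ` and `ν` in the local growth rule. -/
def shrinkFun (μ ν ρ : YoungDiagram) (i : ℕ) : ℕ :=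
  max (μ.rowLen (i + 1)) (ν.rowLen (i + 1)) + min (μ.rowLen i) (ν.rowLen i) - ρ.rowLen (i + 1)

section Growth

variable {μ ν κ ρ : YoungDiagram} {k : ℕ}

theorem rowLen_growth (h1 : IsHorizontalStrip κ μ) (h2 : IsHorizontalStrip κ ν) (k i : ℕ) :
    (ofRowFun (growthFun μ ν κ k)).rowLen i = growthFun μ ν κ k i := by
  obtain ⟨n, hμ, hν, hκ⟩ := exists_rowLen_eq_zero μ ν κ
  refine rowLen_ofRowFun (antitone_nat_of_succ_le fun i => ?_) (n := n + 1) ?_ i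
  · cases i with
    | zero =>
      have := h1 0
      have := h2 0
      simp only [growthFun]
      omega
    | succ i =>
      have := h1 (i + 1)
      have := h2 (i + 1)
      have := h1 i
      have := h2 i
      simp only [growthFun]
      omega
  · have := μ.rowLen_anti _ _ n.le_succ
    have := ν.rowLen_anti _ _ n.le_succ
    simp only [growthFun, Nat.succ_eq_add_one] at *
    omega

theorem rowLen_shrink (h1 : IsHorizontalStrip μ ρ) (h2 : IsHorizontalStrip ν ρ) (i : ℕ) :
    (ofRowFun (shrinkFun μ ν ρ)).rowLen i = shrinkFun μ ν ρ i := by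
  obtain ⟨n, hμ, hν, -⟩ := exists_rowLen_eq_zero μ ν ρ
  refine rowLen_ofRowFun (antitone_nat_of_succ_le fun i => ?_) (n := n) ?_ i
  · have := h1 (i + 1)
    have := h2 (i + 1)
    have := h1 i
    have := h2 i
    have := h1 (i + 1 + 1)
    have := h2 (i + 1 + 1)
    simp only [shrinkFun]
    omega
  · have := μ.rowLen_anti _ _ n.le_succ
    have := ν.rowLen_anti _ _ n.le_succ
    simp only [shrinkFun, Nat.succ_eq_add_one] at *
    omega

theorem card_growth (h : ∀ i, ρ.rowLen i = growthFun μ ν κ k i)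
    (h1 : IsHorizontalStrip κ μ) (h2 : IsHorizontalStrip κ ν) :
    ρ.cells.card + κ.cells.card = μ.cells.card + ν.cells.card + k := by
  obtain ⟨n, hμ, hν, hκ⟩ := exists_rowLen_eq_zero μ ν κ
  have hμ' := μ.rowLen_anti _ _ n.le_succ
  have hν' := ν.rowLen_anti _ _ n.le_succ
  have hρ : ρ.rowLen (n + 1) = 0 := by
    rw [h, growthFun]
    simp only [Nat.succ_eq_add_one] at *
    omega
  rw [card_cells_eq_sum_rowLen ρ hρ, card_cells_eq_sum_rowLen κ hκ,
    card_cells_eq_sum_rowLen μ hμ, card_cells_eq_sum_rowLen ν hν]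
  have key (j : ℕ) : ∑ i ∈ Finset.range (j + 1), ρ.rowLen i + ∑ i ∈ Finset.range j, κ.rowLen i
      = ∑ i ∈ Finset.range j, μ.rowLen i + ∑ i ∈ Finset.range j, ν.rowLen i + k
        + max (μ.rowLen j) (ν.rowLen j) := by
    induction j with
    | zero => simp [h, growthFun]; omega
    | succ j ih =>
      have := h1 j
      have := h2 j
      rw [Finset.sum_range_succ, h, growthFun]
      simp only [Finset.sum_range_succ _ j] at ih ⊢
      omega
  have := key n
  omega

theorem isHorizontalStrip_growth (h : ∀ i, ρ.rowLen i = growthFun μ ν κ k i)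
    (h1 : IsHorizontalStrip κ μ) (h2 : IsHorizontalStrip κ ν) :
    IsHorizontalStrip μ ρ ∧ IsHorizontalStrip ν ρ := by
  have key (i : ℕ) : (μ.rowLen i ≤ ρ.rowLen i ∧ ν.rowLen i ≤ ρ.rowLen i) ∧
      ρ.rowLen (i + 1) ≤ μ.rowLen i ∧ ρ.rowLen (i + 1) ≤ ν.rowLen i := by
    have := h1 i
    have := h2 i
    rw [h, h]
    refine ⟨?_, ?_⟩
    · cases i with
      | zero => simp only [growthFun]; omega
      | succ i =>
        have := h1 i
        have := h2 i
        simp only [growthFun]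
        omega
    · simp only [growthFun]
      omega
  exact ⟨fun i => ⟨(key i).1.1, (key i).2.1⟩, fun i => ⟨(key i).1.2, (key i).2.2⟩⟩

theorem isHorizontalStrip_shrink (h : ∀ i, κ.rowLen i = shrinkFun μ ν ρ i)
    (h1 : IsHorizontalStrip μ ρ) (h2 : IsHorizontalStrip ν ρ) :
    IsHorizontalStrip κ μ ∧ IsHorizontalStrip κ ν := by
  have key (i : ℕ) : (κ.rowLen i ≤ μ.rowLen i ∧ κ.rowLen i ≤ ν.rowLen i) ∧
      μ.rowLen (i + 1) ≤ κ.rowLen i ∧ ν.rowLen (i + 1) ≤ κ.rowLen i := by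
    have := h1 i
    have := h2 i
    have := h1 (i + 1)
    have := h2 (i + 1)
    rw [h, shrinkFun]
    omega
  exact ⟨fun i => ⟨(key i).1.1, (key i).2.1⟩, fun i => ⟨(key i).1.2, (key i).2.2⟩⟩

theorem shrink_of_growth (h : ∀ i, ρ.rowLen i = growthFun μ ν κ k i)
    (h1 : IsHorizontalStrip κ μ) (h2 : IsHorizontalStrip κ ν) :
    ofRowFun (shrinkFun μ ν ρ) = κ ∧ ρ.rowLen 0 - max (μ.rowLen 0) (ν.rowLen 0) = k := by
  obtain ⟨h3, h4⟩ := isHorizontalStrip_growth h h1 h2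
  refine ⟨ext_rowLen fun i => ?_, by rw [h, growthFun]; omega⟩
  have := h1 i
  have := h2 i
  rw [rowLen_shrink h3 h4, shrinkFun, h, growthFun]
  omega

theorem rowLen_eq_growthFun (h : ∀ i, κ.rowLen i = shrinkFun μ ν ρ i)
    (h1 : IsHorizontalStrip μ ρ) (h2 : IsHorizontalStrip ν ρ) (i : ℕ) :
    ρ.rowLen i = growthFun μ ν κ (ρ.rowLen 0 - max (μ.rowLen 0) (ν.rowLen 0)) i := by
  cases i with
  | zero =>
    have := h1 0
    have := h2 0
    rw [growthFun]
    omega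
  | succ i =>
    have := h1 i
    have := h2 i
    have := h1 (i + 1)
    have := h2 (i + 1)
    rw [growthFun, h, shrinkFun]
    omega

end Growth

end YoungDiagram

namespace SemistandardYoungTableau

open YoungDiagram

variable {μ ν : YoungDiagram}

theorem restrict_cells_injective (μ : YoungDiagram) :
    Function.Injective fun (T : SemistandardYoungTableau μ) (c : μ.cells) => T c.1.1 c.1.2 := by
  intro T T' h
  ext i j
  by_cases hc : (i, j) ∈ μ
  · exact congrFun h ⟨(i, j), hc⟩
  · rw [T.zeros hc, T'.zeros hc]

theorem finite_setOf_forall_lt (μ : YoungDiagram) (N : ℕ) :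
    {T : SemistandardYoungTableau μ | ∀ i j, (i, j) ∈ μ → T i j < N}.Finite := by
  refine ((Finset.finite_toSet (Fintype.piFinset fun _ : μ.cells => Finset.range N)).preimage
    (restrict_cells_injective μ).injOn).subset fun T hT => ?_
  exact Finset.mem_coe.2 (Fintype.mem_piFinset.2 fun c => Finset.mem_range.2 (hT _ _ c.2))

/-- The semistandard tableaux of shape `μ` with entries less than `N`. -/
noncomputable def bounded (μ : YoungDiagram) (N : ℕ) : Finset (SemistandardYoungTableau μ) :=
  (finite_setOf_forall_lt μ N).toFinset

@[simp]
theorem mem_bounded {N : ℕ} {T : SemistandardYoungTableau μ} :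
    T ∈ bounded μ N ↔ ∀ i j, (i, j) ∈ μ → T i j < N := by
  simp [bounded]

theorem bounded_mono (μ : YoungDiagram) : Monotone (bounded μ) := fun M N h T hT => by
  rw [mem_bounded] at hT ⊢
  exact fun i j hc => (hT i j hc).trans_le h

theorem exists_mem_bounded (T : SemistandardYoungTableau μ) : ∃ N, T ∈ bounded μ N := by
  refine ⟨μ.cells.sup (fun c => T c.1 c.2) + 1, mem_bounded.2 fun i j hc => ?_⟩
  exact Nat.lt_succ_of_le (Finset.le_sup (f := fun c : ℕ × ℕ => T c.1 c.2) hc)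

/-- The subdiagram of cells of `T` with entry less than `N`. -/
def lowerPart (N : ℕ) (T : SemistandardYoungTableau μ) : YoungDiagram where
  cells := μ.cells.filter fun c => T c.1 c.2 < N
  isLowerSet := by
    intro a b hle hc
    obtain ⟨hi, hj⟩ := Prod.mk_le_mk.1 hle
    obtain ⟨hc1, hc2⟩ := Finset.mem_filter.1 (Finset.mem_coe.1 hc)
    refine Finset.mem_coe.2 (Finset.mem_filter.2 ⟨μ.isLowerSet hle hc1, ?_⟩)
    exact ((T.row_weak_of_le hj (μ.up_left_mem hi le_rfl hc1)).trans
      (T.col_weak hi hc1)).trans_lt hc2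

theorem mem_lowerPart {N : ℕ} {T : SemistandardYoungTableau μ} {i j : ℕ} :
    (i, j) ∈ lowerPart N T ↔ (i, j) ∈ μ ∧ T i j < N :=
  Finset.mem_filter

theorem isHorizontalStrip_lowerPart {N : ℕ} {T : SemistandardYoungTableau μ}
    (hT : T ∈ bounded μ (N + 1)) : IsHorizontalStrip (lowerPart N T) μ := by
  rw [mem_bounded] at hT
  refine fun i => ⟨le_of_forall_lt fun j hj => ?_, le_of_forall_lt fun j hj => ?_⟩
  · exact mem_iff_lt_rowLen.1 (mem_lowerPart.1 (mem_iff_lt_rowLen.2 hj)).1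
  · have hc : (i + 1, j) ∈ μ := mem_iff_lt_rowLen.2 hj
    have h1 := T.col_strict i.lt_succ_self hc
    have h2 := hT _ _ hc
    exact mem_iff_lt_rowLen.1 (mem_lowerPart.2
      ⟨μ.up_left_mem i.le_succ le_rfl hc, by simp only [Nat.succ_eq_add_one] at *; omega⟩)

/-- Restriction of a tableau to a smaller diagram. -/
def restrict (h : ν ≤ μ) (T : SemistandardYoungTableau μ) : SemistandardYoungTableau ν where
  entry i j := if (i, j) ∈ ν then T i j else 0
  row_weak' hj hc := by
    rw [if_pos hc, if_pos (ν.up_left_mem le_rfl hj.le hc)]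
    exact T.row_weak hj (h hc)
  col_strict' hi hc := by
    rw [if_pos hc, if_pos (ν.up_left_mem hi.le le_rfl hc)]
    exact T.col_strict hi (h hc)
  zeros' hc := if_neg hc

theorem restrict_apply (h : ν ≤ μ) (T : SemistandardYoungTableau μ) (i j : ℕ) :
    restrict h T i j = if (i, j) ∈ ν then T i j else 0 :=
  rfl

/-- The tableau obtained by filling the horizontal strip `μ / ν` with the entry `N`. -/
def extend {N : ℕ} (h : IsHorizontalStrip ν μ) (T : SemistandardYoungTableau ν)
    (hT : T ∈ bounded ν N) : SemistandardYoungTableau μ where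
  entry i j := if (i, j) ∈ ν then T i j else if (i, j) ∈ μ then N else 0
  row_weak' := by
    intro i j1 j2 hj hc
    rw [mem_bounded] at hT
    by_cases h2 : (i, j2) ∈ ν
    · have h1 := ν.up_left_mem le_rfl hj.le h2
      rw [if_pos h2, if_pos h1]
      exact T.row_weak hj h2
    · rw [if_neg h2, if_pos hc, if_pos (μ.up_left_mem le_rfl hj.le hc)]
      split_ifs with h1
      · exact (hT _ _ h1).le
      · exact le_rfl
  col_strict' := by
    intro i1 i2 j hi hc
    rw [mem_bounded] at hT
    have h1 : (i1, j) ∈ ν := by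
      have h3 : j < μ.rowLen (i1 + 1) := mem_iff_lt_rowLen.1 (μ.up_left_mem hi le_rfl hc)
      exact mem_iff_lt_rowLen.2 (h3.trans_le (h i1).2)
    rw [if_pos h1]
    by_cases h2 : (i2, j) ∈ ν
    · rw [if_pos h2]
      exact T.col_strict hi h2
    · rw [if_neg h2, if_pos hc]
      exact hT _ _ h1
  zeros' := by
    intro i j hc
    rw [if_neg fun h' => hc (h.le h'), if_neg hc]

theorem extend_apply {N : ℕ} (h : IsHorizontalStrip ν μ) (T : SemistandardYoungTableau ν)
    (hT : T ∈ bounded ν N) (i j : ℕ) :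
    extend h T hT i j = if (i, j) ∈ ν then T i j else if (i, j) ∈ μ then N else 0 :=
  rfl

/-- The monomial of a tableau. -/
def weight {R : Type*} [CommSemiring R] (x : ℕ → R) (T : SemistandardYoungTableau μ) : R :=
  ∏ c ∈ μ.cells, x (T c.1 c.2)

/-- The Schur polynomial of `μ` in the variables `x 0, …, x (N - 1)`. -/
noncomputable def schurSum {R : Type*} [CommSemiring R] (x : ℕ → R) (N : ℕ)
    (μ : YoungDiagram) : R :=
  ∑ T ∈ bounded μ N, weight x T

section Branching

variable {R : Type*} [CommSemiring R] (x : ℕ → R)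

theorem schurSum_zero (μ : YoungDiagram) [Decidable (μ = ⊥)] :
    schurSum x 0 μ = if μ = ⊥ then 1 else 0 := by
  split_ifs with h
  · subst h
    have : bounded (⊥ : YoungDiagram) 0 = {highestWeight ⊥} := by
      ext T
      simp only [mem_bounded, notMem_bot, false_imp_iff, implies_true, Finset.mem_singleton,
        true_iff]
      ext i j
      rw [T.zeros (notMem_bot _), (highestWeight ⊥).zeros (notMem_bot _)]
    simp [schurSum, this, weight]
  · refine Finset.sum_eq_zero fun T hT => absurd ?_ h
    rw [mem_bounded] at hT
    refine YoungDiagram.ext (Finset.eq_empty_of_forall_notMem fun c hc => ?_)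
    exact absurd (hT _ _ hc) (Nat.not_lt_zero _)

theorem weight_eq_of_lowerPart_eq {N : ℕ} {T : SemistandardYoungTableau μ}
    (hT : T ∈ bounded μ (N + 1)) (h : lowerPart N T = ν) (hle : ν ≤ μ) :
    weight x T = x N ^ (μ.cells.card - ν.cells.card) * weight x (restrict hle T) := by
  have hs := cells_subset_iff.2 hle
  rw [weight, ← Finset.prod_sdiff hs, weight, ← Finset.card_sdiff_of_subset hs]
  congr 1
  · rw [← Finset.prod_const]
    refine Finset.prod_congr rfl fun c hc => ?_
    obtain ⟨h1, h2⟩ := Finset.mem_sdiff.1 hc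
    have h3 := mem_bounded.1 hT _ _ h1
    have h4 : ¬ T c.1 c.2 < N := fun hlt => h2 (h ▸ mem_lowerPart.2 ⟨h1, hlt⟩)
    rw [show T c.1 c.2 = N by omega]
  · refine Finset.prod_congr rfl fun c hc => ?_
    rw [restrict_apply, if_pos (show (c.1, c.2) ∈ ν from hc)]

/-- The branching rule for Schur polynomials. -/
theorem schurSum_succ (N : ℕ) (μ : YoungDiagram) :
    schurSum x (N + 1) μ =
      ∑ ν ∈ stripRemovals μ, x N ^ (μ.cells.card - ν.cells.card) * schurSum x N ν := by
  classical
  rw [schurSum, ← Finset.sum_fiberwise_of_maps_to (g := lowerPart N) (t := stripRemovals μ)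
    fun T hT => mem_stripRemovals.2 (isHorizontalStrip_lowerPart hT)]
  refine Finset.sum_congr rfl fun ν hν => ?_
  rw [mem_stripRemovals] at hν
  rw [schurSum, Finset.mul_sum]
  refine Finset.sum_bij' (fun T _ => restrict hν.le T) (fun T hT => extend hν T hT)
    (fun T hT => ?_) (fun T hT => ?_) (fun T hT => ?_) (fun T hT => ?_) (fun T hT => ?_)
  · obtain ⟨h1, rfl⟩ := Finset.mem_filter.1 hT
    refine mem_bounded.2 fun i j hc => ?_
    rw [restrict_apply, if_pos hc]
    exact (mem_lowerPart.1 hc).2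
  · have hT' := mem_bounded.1 hT
    refine Finset.mem_filter.2 ⟨mem_bounded.2 fun i j hc => ?_, SetLike.ext fun ⟨i, j⟩ => ?_⟩
    · rw [extend_apply, if_pos hc]
      split_ifs with h
      · exact (hT' _ _ h).trans N.lt_succ_self
      · exact N.lt_succ_self
    · rw [mem_lowerPart, extend_apply]
      refine ⟨fun ⟨h1, h2⟩ => ?_, fun h => ⟨hν.le h, by rw [if_pos h]; exact hT' _ _ h⟩⟩
      by_contra h
      rw [if_neg h, if_pos h1] at h2
      exact lt_irrefl _ h2
  · obtain ⟨h1, rfl⟩ := Finset.mem_filter.1 hT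
    ext i j
    rw [extend_apply, restrict_apply]
    split_ifs with h2 h3
    · rfl
    · have h4 := mem_bounded.1 h1 _ _ h3
      have h5 : ¬ T i j < N := fun h => h2 (mem_lowerPart.2 ⟨h3, h⟩)
      omega
    · exact (T.zeros h3).symm
  · ext i j
    rw [restrict_apply, extend_apply]
    split_ifs with h
    · rfl
    · exact (T.zeros h).symm
  · obtain ⟨h1, h2⟩ := Finset.mem_filter.1 hT
    exact weight_eq_of_lowerPart_eq x h1 h2 hν.le

end Branching

end SemistandardYoungTableau

namespace YoungDiagram

/-- The Young diagram consisting of a single row of length `m`. -/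
noncomputable def singleRow (m : ℕ) : YoungDiagram :=
  ofRowFun fun i => if i = 0 then m else 0

theorem rowLen_singleRow (m i : ℕ) : (singleRow m).rowLen i = if i = 0 then m else 0 := by
  refine rowLen_ofRowFun (antitone_nat_of_succ_le fun i => ?_) (n := 1) rfl i
  simp

theorem mem_singleRow {m i j : ℕ} : (i, j) ∈ singleRow m ↔ i = 0 ∧ j < m := by
  rw [mem_iff_lt_rowLen, rowLen_singleRow]
  split_ifs with h <;> simp [h]

theorem cells_singleRow (m : ℕ) :
    (singleRow m).cells = (Finset.range m).map (Function.Embedding.sectR 0 ℕ) := by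
  ext ⟨i, j⟩
  simp only [mem_cells, mem_singleRow, Finset.mem_map, Finset.mem_range,
    Function.Embedding.sectR_apply, Prod.mk.injEq]
  exact ⟨fun ⟨hi, hj⟩ => ⟨j, hj, hi.symm, rfl⟩, fun ⟨_, ha, hi, hj⟩ => ⟨hi.symm, hj ▸ ha⟩⟩

@[simp]
theorem card_singleRow (m : ℕ) : (singleRow m).cells.card = m := by
  simp [cells_singleRow]

theorem singleRow_eq_bot_iff {m : ℕ} : singleRow m = ⊥ ↔ m = 0 := by
  rw [eq_bot_iff_card_eq_zero, card_singleRow]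

theorem isHorizontalStrip_singleRow_iff {ν : YoungDiagram} {m : ℕ} :
    IsHorizontalStrip ν (singleRow m) ↔ ∃ k ≤ m, ν = singleRow k := by
  simp only [IsHorizontalStrip, rowLen_singleRow]
  refine ⟨fun h => ⟨ν.rowLen 0, by simpa using (h 0).1, ext_rowLen fun i => ?_⟩, ?_⟩
  · rw [rowLen_singleRow]
    split_ifs with hi
    · rw [hi]
    · simpa [hi] using (h i).1
  · rintro ⟨k, hk, rfl⟩ i
    rw [rowLen_singleRow]
    split_ifs <;> simp_all

end YoungDiagram

namespace SemistandardYoungTableau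

open YoungDiagram

section Pieri

variable {R : Type*} [CommSemiring R] (x : ℕ → R)

theorem schurSum_succ_singleRow (N m : ℕ) :
    schurSum x (N + 1) (singleRow m) =
      ∑ k ∈ Finset.range (m + 1), x N ^ k * schurSum x N (singleRow (m - k)) := by
  rw [schurSum_succ]
  refine Finset.sum_bij' (fun ν _ => m - ν.rowLen 0) (fun k _ => singleRow (m - k))
    (fun ν hν => ?_) (fun k hk => ?_) (fun ν hν => ?_) (fun k hk => ?_) (fun ν hν => ?_)
  · exact Finset.mem_range.2 (by omega)
  · rw [mem_stripRemovals, isHorizontalStrip_singleRow_iff]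
    exact ⟨m - k, m.sub_le k, rfl⟩
  · obtain ⟨k, hk, rfl⟩ := isHorizontalStrip_singleRow_iff.1 (mem_stripRemovals.1 hν)
    rw [rowLen_singleRow, if_pos rfl, Nat.sub_sub_self hk]
  · rw [rowLen_singleRow, if_pos rfl, Nat.sub_sub_self (Finset.mem_range_succ_iff.1 hk)]
  · obtain ⟨k, hk, rfl⟩ := isHorizontalStrip_singleRow_iff.1 (mem_stripRemovals.1 hν)
    rw [rowLen_singleRow, if_pos rfl, Nat.sub_sub_self hk, card_singleRow, card_singleRow]

/-- The local growth rule, as an identity between sums over pairs of horizontal strips. -/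
theorem sum_stripRemovals_stripAdditions (y : R) (g : YoungDiagram → R) (μ : YoungDiagram)
    (m : ℕ) :
    ∑ κ ∈ stripRemovals μ, ∑ k ∈ Finset.range (m + 1), ∑ ν ∈ stripAdditions κ (m - k),
        y ^ (μ.cells.card - κ.cells.card + k) * g ν =
      ∑ ρ ∈ stripAdditions μ m, ∑ ν ∈ stripRemovals ρ,
        y ^ (ρ.cells.card - ν.cells.card) * g ν := by
  simp only [Finset.sum_sigma']
  refine Finset.sum_bij'
    (fun p _ => ⟨ofRowFun (growthFun μ p.2.2 p.1 p.2.1), p.2.2⟩)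
    (fun q _ => ⟨ofRowFun (shrinkFun μ q.2 q.1),
      q.1.rowLen 0 - max (μ.rowLen 0) (q.2.rowLen 0), q.2⟩) ?_ ?_ ?_ ?_ ?_
  · rintro ⟨κ, k, ν⟩ hp
    simp only [Finset.mem_sigma, mem_stripRemovals, mem_stripAdditions,
      Finset.mem_range_succ_iff] at hp ⊢
    obtain ⟨h1, hk, h2, hc⟩ := hp
    obtain ⟨h3, h4⟩ := isHorizontalStrip_growth (rowLen_growth h1 h2 k) h1 h2
    have := card_growth (rowLen_growth h1 h2 k) h1 h2
    exact ⟨⟨h3, by omega⟩, h4⟩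
  · rintro ⟨ρ, ν⟩ hq
    simp only [Finset.mem_sigma, mem_stripRemovals, mem_stripAdditions,
      Finset.mem_range_succ_iff] at hq ⊢
    obtain ⟨⟨h1, hc⟩, h2⟩ := hq
    obtain ⟨h3, h4⟩ := isHorizontalStrip_shrink (rowLen_shrink h1 h2) h1 h2
    have := card_growth (rowLen_eq_growthFun (rowLen_shrink h1 h2) h1 h2) h3 h4
    have := h4.card_le
    exact ⟨h3, by omega, h4, by omega⟩
  · rintro ⟨κ, k, ν⟩ hp
    simp only [Finset.mem_sigma, mem_stripRemovals, mem_stripAdditions] at hp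
    obtain ⟨h1, -, h2, -⟩ := hp
    obtain ⟨h3, h4⟩ := shrink_of_growth (rowLen_growth h1 h2 k) h1 h2
    simp only [h3, h4]
  · rintro ⟨ρ, ν⟩ hq
    simp only [Finset.mem_sigma, mem_stripRemovals, mem_stripAdditions] at hq
    obtain ⟨⟨h1, -⟩, h2⟩ := hq
    obtain ⟨h3, h4⟩ := isHorizontalStrip_shrink (rowLen_shrink h1 h2) h1 h2
    have h5 : ofRowFun (growthFun μ ν (ofRowFun (shrinkFun μ ν ρ))
        (ρ.rowLen 0 - max (μ.rowLen 0) (ν.rowLen 0))) = ρ := ext_rowLen fun i => by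
      rw [rowLen_growth h3 h4, ← rowLen_eq_growthFun (rowLen_shrink h1 h2) h1 h2]
    simp only [h5]
  · rintro ⟨κ, k, ν⟩ hp
    simp only [Finset.mem_sigma, mem_stripRemovals, mem_stripAdditions] at hp
    obtain ⟨h1, -, h2, -⟩ := hp
    have h3 := card_growth (rowLen_growth h1 h2 k) h1 h2
    have h4 := h1.card_le
    congr 2
    dsimp only
    omega

/-- The Pieri rule for Schur polynomials. -/
theorem schurSum_mul_schurSum_singleRow (N m : ℕ) (μ : YoungDiagram) :
    schurSum x N μ * schurSum x N (singleRow m) = ∑ ρ ∈ stripAdditions μ m, schurSum x N ρ := by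
  classical
  induction N generalizing μ m with
  | zero =>
    simp only [schurSum_zero, Finset.sum_ite_eq', mem_stripAdditions, singleRow_eq_bot_iff,
      ← ite_and, mul_ite, mul_one, mul_zero]
    refine if_congr ?_ rfl rfl
    constructor
    · rintro ⟨rfl, rfl⟩
      exact ⟨fun i => ⟨le_rfl, rowLen_anti _ _ _ i.le_succ⟩, rfl⟩
    · rintro ⟨-, h⟩
      rw [cells_bot, Finset.card_empty] at h
      rw [eq_bot_iff_card_eq_zero]
      omega
  | succ N ih =>
    simp only [schurSum_succ x N μ, schurSum_succ_singleRow, Finset.sum_mul_sum]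
    simp only [schurSum_succ, ← sum_stripRemovals_stripAdditions]
    refine Finset.sum_congr rfl fun κ _ => Finset.sum_congr rfl fun k _ => ?_
    rw [← Finset.mul_sum, ← ih, pow_add]
    ring

end Pieri

section Summable

variable {μ : YoungDiagram} {x : ℕ → ℂ}

theorem weight_eq_prod_subtype {R : Type*} [CommSemiring R] (x : ℕ → R)
    (T : SemistandardYoungTableau μ) :
    weight x T = ∏ c : μ.cells, x (T c.1.1 c.1.2) :=
  (Finset.prod_coe_sort μ.cells fun c => x (T c.1 c.2)).symm

theorem summable_weight (hx : Summable fun n => ‖x n‖) (μ : YoungDiagram) :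
    Summable (weight x : SemistandardYoungTableau μ → ℂ) := by
  classical
  have key : Summable fun f : μ.cells → ℕ => ∏ c, ‖x (f c)‖ := by
    refine summable_of_sum_le (c := (∑' n, ‖x n‖) ^ Fintype.card μ.cells)
      (fun f => Finset.prod_nonneg fun c _ => norm_nonneg _) fun s => ?_
    have hs : s ⊆ Fintype.piFinset fun c => s.image fun f => f c := fun f hf =>
      Fintype.mem_piFinset.2 fun c => Finset.mem_image_of_mem _ hf
    refine (Finset.sum_le_sum_of_subset_of_nonneg hs fun f _ _ =>
      Finset.prod_nonneg fun c _ => norm_nonneg _).trans ?_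
    rw [← Finset.prod_univ_sum (fun c => s.image fun f => f c) fun _ n => ‖x n‖]
    refine (Finset.prod_le_prod (fun c _ => Finset.sum_nonneg fun _ _ => norm_nonneg _)
      fun c _ => hx.sum_le_tsum _ fun _ _ => norm_nonneg _).trans_eq ?_
    rw [Finset.prod_const, Finset.card_univ]
  refine Summable.of_norm ((key.comp_injective (restrict_cells_injective μ)).congr fun T => ?_)
  rw [weight_eq_prod_subtype, norm_prod]
  rfl

theorem tendsto_schurSum (hx : Summable fun n => ‖x n‖) (μ : YoungDiagram) :
    Filter.Tendsto (fun N => schurSum x N μ) Filter.atTop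
      (nhds (∑' T : SemistandardYoungTableau μ, weight x T)) :=
  (summable_weight hx μ).hasSum.comp
    (Filter.tendsto_atTop_finset_of_monotone (bounded_mono μ) exists_mem_bounded)

/-- The Pieri rule for Schur functions in infinitely many variables. -/
theorem tsum_weight_mul_tsum_weight_singleRow (hx : Summable fun n => ‖x n‖)
    (μ : YoungDiagram) (m : ℕ) :
    (∑' T : SemistandardYoungTableau μ, weight x T) *
        ∑' T : SemistandardYoungTableau (singleRow m), weight x T =
      ∑ ρ ∈ stripAdditions μ m, ∑' T : SemistandardYoungTableau ρ, weight x T := by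
  refine tendsto_nhds_unique
    ((tendsto_schurSum hx μ).mul (tendsto_schurSum hx (singleRow m))) ?_
  simp only [schurSum_mul_schurSum_singleRow]
  exact tendsto_finsetSum _ fun ρ _ => tendsto_schurSum hx ρ

end Summable

/-- Tableaux with a single row correspond to monotone functions. -/
noncomputable def singleRowEquiv (m : ℕ) :
    SemistandardYoungTableau (singleRow m) ≃ {f : Fin m → ℕ+ // Monotone f} where
  toFun T := ⟨fun j => (T 0 j).succPNat, fun _ j₂ h =>
    Nat.succPNat_mono (T.row_weak_of_le h (mem_singleRow.2 ⟨rfl, j₂.2⟩))⟩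
  invFun f :=
    { entry i j := if h : i = 0 ∧ j < m then (f.1 ⟨j, h.2⟩).natPred else 0
      row_weak' := by
        intro i j₁ j₂ hj hc
        obtain ⟨hi, hj₂⟩ := mem_singleRow.1 hc
        rw [dif_pos ⟨hi, hj.trans hj₂⟩, dif_pos ⟨hi, hj₂⟩]
        exact PNat.natPred_monotone (f.2 (Fin.mk_le_mk.2 hj.le))
      col_strict' := by
        intro i₁ i₂ j hi hc
        exact absurd ((mem_singleRow.1 hc).1 ▸ hi) (Nat.not_lt_zero _)
      zeros' := by
        intro i j hc
        exact dif_neg fun h => hc (mem_singleRow.2 h) }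
  left_inv T := by
    ext i j
    change (if h : i = 0 ∧ j < m then _ else 0) = _
    split_ifs with h
    · obtain ⟨rfl, hj⟩ := h
      exact Nat.natPred_succPNat _
    · exact (T.zeros fun hc => h (mem_singleRow.1 hc)).symm
  right_inv f := by
    refine Subtype.ext (funext fun j => ?_)
    change Nat.succPNat (if h : 0 = 0 ∧ (j : ℕ) < m then (f.1 ⟨j, h.2⟩).natPred else 0) = _
    rw [dif_pos ⟨rfl, j.2⟩]
    exact PNat.succPNat_natPred _

end SemistandardYoungTableau

open YoungDiagram SemistandardYoungTableau in
theorem MZSV_replicate (m : ℕ) (s : ℂ) :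
    MZSV (List.replicate m s) = ∑' T : SemistandardYoungTableau (singleRow m),
      weight (fun n => ((n + 1 : ℕ) : ℂ) ^ (-s)) T := by
  have h1 : MZSV (List.replicate m s) =
      ∑' n : {f : Fin (List.replicate m s).length → ℕ+ // Monotone f},
        ∏ i, (n.1 i : ℂ) ^ (-s) := by
    simp [MZSV]
  rw [h1, List.length_replicate, ← (singleRowEquiv m).tsum_eq]
  refine tsum_congr fun T => ?_
  rw [weight, cells_singleRow, Finset.prod_map, Finset.prod_range]
  rfl

theorem summable_norm_succ_cpow_neg {s : ℂ} (hs : 1 < s.re) :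
    Summable fun n : ℕ => ‖((n + 1 : ℕ) : ℂ) ^ (-s)‖ := by
  have h := (summable_nat_add_iff 1).2 (Real.summable_nat_rpow.2 (neg_lt_neg hs))
  refine h.congr fun n => ?_
  rw [Complex.norm_natCast_cpow_of_pos n.succ_pos, Complex.neg_re]

/-- the Pieri formula for Schur multiple zeta functions with all variables
equal to `s` : multiplying by `ζ⋆(s,…,s)` (`m` copies) adds a horizontal strip of `m`
boxes in all possible ways. -/
theorem stmt11 (lam : YoungDiagram) (m : ℕ) (hm : 1 ≤ m) (s : ℂ) (hs : 1 < s.re) :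
    schurZeta lam (fun _ _ => s) * MZSV (List.replicate m s)
    = ∑' mu : {mu : YoungDiagram // lam ≤ mu ∧ mu.cells.card = lam.cells.card + m ∧
        ∀ i₁ i₂ j : ℕ, (i₁, j) ∈ mu.cells → (i₁, j) ∉ lam.cells →
          (i₂, j) ∈ mu.cells → (i₂, j) ∉ lam.cells → i₁ = i₂},
        schurZeta mu.1 (fun _ _ => s) := by
  rw [MZSV_replicate]
  refine (SemistandardYoungTableau.tsum_weight_mul_tsum_weight_singleRow
    (summable_norm_succ_cpow_neg hs) lam m).trans ?_
  rw [← Finset.tsum_subtype]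
  refine (Equiv.subtypeEquivRight fun mu => ?_).tsum_eq
    (fun mu : {mu : YoungDiagram // lam ≤ mu ∧ mu.cells.card = lam.cells.card + m ∧
      ∀ i₁ i₂ j : ℕ, (i₁, j) ∈ mu.cells → (i₁, j) ∉ lam.cells →
        (i₂, j) ∈ mu.cells → (i₂, j) ∉ lam.cells → i₁ = i₂} => schurZeta mu.1 fun _ _ => s)
  rw [YoungDiagram.mem_stripAdditions, YoungDiagram.isHorizontalStrip_iff]
  tauto
end
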